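/- Let n ∈ ℕ, α > 1 and f ∈ SR_α with ∫_{ℝⁿ} exp(−f(‖z‖)) dz = 1, and let p_m be the m-fold convolution power density as in the context. Then for every δ > 0 there exists k > 0 such that for all m ∈ ℕ and all x ∈ ℝⁿ with ‖x‖ > k·m: p_m(x) ≤ (α−1)^{(n−1)(m−1)/2}·(2π/f″(‖x‖/m))^{n(m−1)/2}·exp(−m·(f(‖x‖/m) − δ)), and p_m(x) ≥ m^{−n/2}·(α−1)^{(n−1)(m−1)/2}·(2π/f″(‖x‖/m))^{n(m−1)/2}·exp(−m·(f(‖x‖/m) + δ)). -/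

import Mathlib

open MeasureTheory Filter Real Set
open scoped Topology BigOperators ENNReal RealInnerProductSpace

noncomputable section

/-- `f` is smoothly regularly varying of index `α`: beyond some `z₀ ≥ 1` it is positive and
infinitely differentiable, and `h u = log (f (exp u))` satisfies `h' → α` and
`h^(m) → 0` for every `m ≥ 2`. -/
def SmoothRegVary (α : ℝ) (f : ℝ → ℝ) : Prop :=
  ∃ z₀ : ℝ, 1 ≤ z₀ ∧ (∀ x, z₀ < x → 0 < f x) ∧
    ContDiffOn ℝ (⊤ : ℕ∞) f (Set.Ioi z₀) ∧
    Filter.Tendsto (deriv (fun u => Real.log (f (Real.exp u)))) Filter.atTop (nhds α) ∧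
    ∀ m : ℕ, 2 ≤ m →
      Filter.Tendsto (iteratedDeriv m (fun u => Real.log (f (Real.exp u))))
        Filter.atTop (nhds 0)

/-- `convPow n p m` is the `(m+1)`-fold convolution power of the density `p` on `ℝⁿ`;
so `convPow n p 0 = p` and `convPow n p (m+1) = (convPow n p m) ⋆ p`. -/
def convPow (n : ℕ) (p : EuclideanSpace ℝ (Fin n) → ℝ) : ℕ → EuclideanSpace ℝ (Fin n) → ℝ
  | 0 => p
  | m + 1 => fun x => ∫ y, convPow n p m (x - y) * p y

/-- `cpDensity n f t x = Σ_{m≥1} e^{-t} tᵐ/m! · p_m(x)`, the density (away from 0) of the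
time-`t` marginal of the compound Poisson process with jump density `exp (-f ‖z‖)`. -/
def cpDensity (n : ℕ) (f : ℝ → ℝ) (t : ℝ) (x : EuclideanSpace ℝ (Fin n)) : ℝ :=
  ∑' m : ℕ, Real.exp (-t) * t ^ (m + 1) / (Nat.factorial (m + 1) : ℝ) *
    convPow n (fun z => Real.exp (-f ‖z‖)) m x
section ConvPow

variable {n : ℕ} {p : EuclideanSpace ℝ (Fin n) → ℝ}

lemma convPow_nonneg (hp : ∀ y, 0 ≤ p y) (m : ℕ) (x : EuclideanSpace ℝ (Fin n)) :
    0 ≤ convPow n p m x := by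
  induction m generalizing x with
  | zero => exact hp x
  | succ m ih => exact integral_nonneg fun y => mul_nonneg (ih _) (hp y)

lemma convPow_succ_eq_convolution (m : ℕ) :
    convPow n p (m + 1) =
      MeasureTheory.convolution p (convPow n p m) (ContinuousLinearMap.mul ℝ ℝ) volume := by
  funext x
  simp only [convPow, MeasureTheory.convolution, ContinuousLinearMap.mul_apply']
  exact integral_congr_ae (Eventually.of_forall fun y => mul_comm _ _)

lemma integrable_convPow (hp : Integrable p) (m : ℕ) : Integrable (convPow n p m) := by
  induction m with
  | zero => exact hp
  | succ m ih =>
    rw [convPow_succ_eq_convolution]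
    exact hp.integrable_convolution _ ih

lemma integral_convPow (hp : Integrable p) (m : ℕ) :
    ∫ x, convPow n p m x = (∫ x, p x) ^ (m + 1) := by
  induction m with
  | zero => simp [convPow]
  | succ m ih =>
    rw [convPow_succ_eq_convolution, integral_convolution _ hp (integrable_convPow hp m), ih]
    simp only [ContinuousLinearMap.mul_apply']
    ring

/-- Exponential tilting commutes with convolution powers. -/
lemma convPow_tilt (c : ℝ) (l : EuclideanSpace ℝ (Fin n) →ₗ[ℝ] ℝ) (m : ℕ)
    (x : EuclideanSpace ℝ (Fin n)) :
    convPow n (fun y => Real.exp (c + l y) * p y) m x =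
      Real.exp ((m + 1) * c + l x) * convPow n p m x := by
  induction m generalizing x with
  | zero => simp [convPow]
  | succ m ih =>
    simp only [convPow, ih, ← integral_const_mul]
    refine integral_congr_ae (Eventually.of_forall fun y => ?_)
    have : Real.exp ((↑(m + 1) + 1) * c + l x)
        = Real.exp ((m + 1) * c + l (x - y)) * Real.exp (c + l y) := by
      rw [← Real.exp_add, map_sub]; push_cast; ring_nf
    simp only [this]
    ring

/-- If a convolution power is bounded away from a ball, then so are the two parts of the integral
defining the next one. -/
lemma convPow_succ_split (hp0 : ∀ y, 0 ≤ p y) (hp : Integrable p) {z B : ℝ} {m : ℕ}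
    (h1 : ∀ y, z < ‖y‖ → p y ≤ 1) (hB : ∀ x, (m + 1) * z < ‖x‖ → convPow n p m x ≤ B)
    {x : EuclideanSpace ℝ (Fin n)} (hx : (m + 2) * z < ‖x‖) :
    Integrable (fun y => convPow n p m (x - y) * p y) ∧
      convPow n p (m + 1) x ≤
        (∫ y, p y) ^ (m + 1) + B * ∫ y in Metric.closedBall 0 z, p y := by
  have hball : ∀ y ∈ Metric.closedBall (0 : EuclideanSpace ℝ (Fin n)) z,
      convPow n p m (x - y) ≤ B := by
    intro y hy
    rw [mem_closedBall_zero_iff] at hy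
    apply hB
    have := norm_sub_norm_le x y
    linarith
  have hcm : Integrable fun y => convPow n p m (x - y) := (integrable_convPow hp m).comp_sub_left x
  have hm : MeasurableSet (Metric.closedBall (0 : EuclideanSpace ℝ (Fin n)) z) :=
    Metric.isClosed_closedBall.measurableSet
  have hS : IntegrableOn (fun y => convPow n p m (x - y) * p y) (Metric.closedBall 0 z) := by
    refine Integrable.bdd_mul (c := B) hp.integrableOn hcm.aestronglyMeasurable.restrict ?_
    refine (ae_restrict_iff' hm).2 (Eventually.of_forall fun y hy => ?_)
    rw [Real.norm_of_nonneg (convPow_nonneg hp0 _ _)]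
    exact hball y hy
  have hSc : IntegrableOn (fun y => convPow n p m (x - y) * p y) (Metric.closedBall 0 z)ᶜ := by
    refine Integrable.mul_bdd (c := 1) hcm.integrableOn hp.aestronglyMeasurable.restrict ?_
    refine (ae_restrict_iff' hm.compl).2 (Eventually.of_forall fun y hy => ?_)
    rw [Real.norm_of_nonneg (hp0 _)]
    exact h1 y (by simpa using hy)
  have hconv : Integrable fun y => convPow n p m (x - y) * p y := by
    rw [← integrableOn_univ, ← union_compl_self (Metric.closedBall 0 z)]
    exact hS.union hSc
  refine ⟨hconv, ?_⟩
  have hcoe : convPow n p (m + 1) x = ∫ y, convPow n p m (x - y) * p y := rfl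
  rw [hcoe, ← integral_add_compl hm hconv, add_comm]
  refine add_le_add ?_ ?_
  · calc ∫ y in (Metric.closedBall 0 z)ᶜ, convPow n p m (x - y) * p y
        ≤ ∫ y in (Metric.closedBall 0 z)ᶜ, convPow n p m (x - y) := by
          refine setIntegral_mono_on hSc hcm.integrableOn hm.compl fun y hy => ?_
          exact mul_le_of_le_one_right (convPow_nonneg hp0 _ _) (h1 y (by simpa using hy))
      _ ≤ ∫ y, convPow n p m (x - y) :=
          setIntegral_le_integral hcm (Eventually.of_forall fun y => convPow_nonneg hp0 _ _)
      _ = (∫ y, p y) ^ (m + 1) := by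
          rw [integral_sub_left_eq_self (convPow n p m) volume x, integral_convPow hp]
  · rw [← integral_const_mul]
    refine setIntegral_mono_on hS (hp.integrableOn.const_mul B) hm fun y hy => ?_
    exact mul_le_mul_of_nonneg_right (hball y hy) (hp0 y)

/-- Away from a ball, convolution powers of a density which is at most `1` outside a small ball
are controlled by the total mass `N` and the mass of that ball. -/
lemma convPow_le (hp0 : ∀ y, 0 ≤ p y) (hp : Integrable p) {z N ε : ℝ}
    (hε0 : 0 ≤ ε) (hε1 : ε < 1) (hN0 : 0 ≤ N)
    (h1 : ∀ y, z < ‖y‖ → p y ≤ 1) (hN : ∫ y, p y ≤ N)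
    (hτ : ∫ y in Metric.closedBall 0 z, p y ≤ ε * N) (m : ℕ) :
    ∀ x, (m + 1) * z < ‖x‖ → convPow n p m x ≤ N ^ m / (1 - ε) := by
  have hε : 0 < 1 - ε := by linarith
  induction m with
  | zero =>
    intro x hx
    have : p x ≤ 1 := h1 x (by simpa using hx)
    simp only [convPow, pow_zero]
    exact this.trans ((one_le_div hε).2 (by linarith))
  | succ m ih =>
    intro x hx
    refine (convPow_succ_split hp0 hp h1 ih (by push_cast at hx; linarith)).2.trans ?_
    have hI : 0 ≤ ∫ y, p y := integral_nonneg hp0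
    calc (∫ y, p y) ^ (m + 1) + N ^ m / (1 - ε) * ∫ y in Metric.closedBall 0 z, p y
        ≤ N ^ (m + 1) + N ^ m / (1 - ε) * (ε * N) := by gcongr
      _ = N ^ (m + 1) / (1 - ε) := by field_simp; ring

/-- The integral defining a convolution power converges away from a ball. -/
lemma integrable_convPow_mul (hp0 : ∀ y, 0 ≤ p y) (hp : Integrable p) {z : ℝ}
    (h1 : ∀ y, z < ‖y‖ → p y ≤ 1) (m : ℕ) {x : EuclideanSpace ℝ (Fin n)}
    (hx : (m + 2) * z < ‖x‖) : Integrable (fun y => convPow n p m (x - y) * p y) := by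
  have hB : ∃ B, ∀ x, (m + 1) * z < ‖x‖ → convPow n p m x ≤ B := by
    clear hx x
    induction m with
    | zero => exact ⟨1, fun x hx => h1 x (by simpa using hx)⟩
    | succ m ih =>
      obtain ⟨B, hB⟩ := ih
      exact ⟨_, fun x hx => (convPow_succ_split hp0 hp h1 hB (by push_cast at hx; linarith)).2⟩
  obtain ⟨B, hB⟩ := hB
  exact (convPow_succ_split hp0 hp h1 hB hx).1

end ConvPow

section Gaussian

variable {n : ℕ}

lemma integral_comp_linearMap (T : EuclideanSpace ℝ (Fin n) →ₗ[ℝ] EuclideanSpace ℝ (Fin n))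
    (hT : LinearMap.det T ≠ 0) (g : EuclideanSpace ℝ (Fin n) → ℝ) :
    ∫ w, g (T w) = |LinearMap.det T|⁻¹ * ∫ w, g w := by
  have hemb : MeasurableEmbedding T :=
    (T.equivOfDetNeZero hT).toContinuousLinearEquiv.toHomeomorph.measurableEmbedding
  rw [← hemb.integral_map, Measure.map_linearMap_addHaar_eq_smul_addHaar volume hT,
    integral_smul_measure, ENNReal.toReal_ofReal (abs_nonneg _), abs_inv, smul_eq_mul]

lemma integrable_comp_linearMap (T : EuclideanSpace ℝ (Fin n) →ₗ[ℝ] EuclideanSpace ℝ (Fin n))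
    (hT : LinearMap.det T ≠ 0) {g : EuclideanSpace ℝ (Fin n) → ℝ} (hg : Integrable g) :
    Integrable fun w => g (T w) := by
  have hemb : MeasurableEmbedding T :=
    (T.equivOfDetNeZero hT).toContinuousLinearEquiv.toHomeomorph.measurableEmbedding
  refine (hemb.integrable_map_iff (g := g)).1 ?_
  rw [Measure.map_linearMap_addHaar_eq_smul_addHaar volume hT]
  exact hg.smul_measure ENNReal.ofReal_ne_top

lemma integral_gaussian_half :
    ∫ t : EuclideanSpace ℝ (Fin n), Real.exp (-‖t‖ ^ 2 / 2) = √(2 * π) ^ n := by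
  have h := GaussianFourier.integral_rexp_neg_mul_sq_norm (V := EuclideanSpace ℝ (Fin n))
    (b := 1 / 2) (by norm_num)
  rw [finrank_euclideanSpace_fin] at h
  rw [Real.sqrt_eq_rpow, ← Real.rpow_mul_natCast (by positivity)]
  convert h using 2
  · funext t; congr 1; ring
  · ring
  · ring

lemma integrable_gaussian_half :
    Integrable fun t : EuclideanSpace ℝ (Fin n) => Real.exp (-‖t‖ ^ 2 / 2) := by
  refine Integrable.of_integral_ne_zero ?_
  rw [integral_gaussian_half]
  positivity

lemma integrable_exp_neg_norm (hn : 0 < n) :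
    Integrable fun t : EuclideanSpace ℝ (Fin n) => Real.exp (-‖t‖) := by
  have : Nonempty (Fin n) := ⟨⟨0, hn⟩⟩
  rw [integrable_fun_norm_addHaar volume (f := fun r => Real.exp (-r)),
    finrank_euclideanSpace_fin]
  have h := Real.GammaIntegral_convergent (s := n) (by exact_mod_cast hn)
  refine h.congr_fun (fun x _ => ?_) measurableSet_Ioi
  simp only [smul_eq_mul]
  rw [mul_comm, ← Real.rpow_natCast x (n - 1), Nat.cast_sub hn, Nat.cast_one]

/-- The Gaussian mass of a ball of radius `K`. -/
def gaussBall (n : ℕ) (K : ℝ) : ℝ :=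
  ∫ t in Metric.closedBall (0 : EuclideanSpace ℝ (Fin n)) K, Real.exp (-‖t‖ ^ 2 / 2)

lemma gaussBall_nonneg (K : ℝ) : 0 ≤ gaussBall n K :=
  integral_nonneg fun _ => (Real.exp_pos _).le

lemma tendsto_gaussBall : Tendsto (gaussBall n) atTop (𝓝 (√(2 * π) ^ n)) := by
  rw [← integral_gaussian_half]
  exact (aecover_closedBall tendsto_id).integral_tendsto_of_countably_generated
    integrable_gaussian_half

/-- One step of a Gaussian random walk confined to a ball, started from a density which is
slightly more concentrated than a Gaussian. -/
lemma gaussian_step {a A K : ℝ} (ha : 0 < a) (haA : a ≤ A) (hK : 0 ≤ K)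
    {u : EuclideanSpace ℝ (Fin n)} (hu : ‖u‖ ≤ K) :
    Real.exp (-(A / (1 + A) * ‖u‖ ^ 2) / 2) * ((√(1 + A) ^ n)⁻¹ * gaussBall n (K * (a / (1 + a))))
      ≤ ∫ z in Metric.closedBall 0 K, Real.exp (-(A * ‖z‖ ^ 2) / 2) *
          Real.exp (-‖u - z‖ ^ 2 / 2) := by
  have hA : 0 < A := ha.trans_le haA
  set R := K * (a / (1 + a)) with hR
  set c : EuclideanSpace ℝ (Fin n) := (1 + A)⁻¹ • u with hc
  set ψ : EuclideanSpace ℝ (Fin n) → ℝ :=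
    (Metric.closedBall 0 R).indicator fun t => Real.exp (-‖t‖ ^ 2 / 2) with hψ
  have hmR : MeasurableSet (Metric.closedBall (0 : EuclideanSpace ℝ (Fin n)) R) :=
    Metric.isClosed_closedBall.measurableSet
  have hmK : MeasurableSet (Metric.closedBall (0 : EuclideanSpace ℝ (Fin n)) K) :=
    Metric.isClosed_closedBall.measurableSet
  have hψi : Integrable ψ := integrable_gaussian_half.indicator hmR
  have hs : 0 < √(1 + A) := Real.sqrt_pos.2 (by linarith)
  have hsq : √(1 + A) ^ 2 = 1 + A := Real.sq_sqrt (by linarith)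
  have h1 : ∫ z, ψ (√(1 + A) • (z - c)) = (√(1 + A) ^ n)⁻¹ * gaussBall n R := by
    rw [integral_sub_right_eq_self (fun z => ψ (√(1 + A) • z)) c,
      Measure.integral_comp_smul_of_nonneg volume ψ _ (hR := hs.le), finrank_euclideanSpace_fin,
      hψ, integral_indicator hmR, smul_eq_mul, gaussBall]
  rw [← h1, ← integral_const_mul, ← integral_indicator hmK]
  have hi1 : Integrable fun z => ψ (√(1 + A) • (z - c)) :=
    (hψi.comp_smul hs.ne').comp_sub_right c
  have hi2 : Integrable ((Metric.closedBall (0 : EuclideanSpace ℝ (Fin n)) K).indicator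
      fun z => Real.exp (-(A * ‖z‖ ^ 2) / 2) * Real.exp (-‖u - z‖ ^ 2 / 2)) := by
    rw [integrable_indicator_iff hmK]
    refine ContinuousOn.integrableOn_compact (isCompact_closedBall _ _) ?_
    fun_prop
  refine integral_mono (hi1.const_mul _) hi2 fun z => ?_
  have hrhs : 0 ≤ (Metric.closedBall (0 : EuclideanSpace ℝ (Fin n)) K).indicator
      (fun z => Real.exp (-(A * ‖z‖ ^ 2) / 2) * Real.exp (-‖u - z‖ ^ 2 / 2)) z :=
    indicator_nonneg (fun _ _ => by positivity) z
  by_cases hz : √(1 + A) • (z - c) ∈ Metric.closedBall (0 : EuclideanSpace ℝ (Fin n)) R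
  · have hz' := hz
    rw [mem_closedBall_zero_iff, norm_smul, Real.norm_of_nonneg hs.le] at hz'
    have hzK : z ∈ Metric.closedBall (0 : EuclideanSpace ℝ (Fin n)) K := by
      rw [mem_closedBall_zero_iff]
      have h2 : ‖z - c‖ ≤ R := by
        refine le_trans ?_ hz'
        exact le_mul_of_one_le_left (norm_nonneg _) (Real.one_le_sqrt.2 (by linarith))
      have h3 : ‖c‖ ≤ K / (1 + a) := by
        rw [hc, norm_smul, Real.norm_of_nonneg (by positivity), inv_mul_eq_div]
        gcongr
      have h4 : ‖z‖ ≤ ‖z - c‖ + ‖c‖ := by simpa using norm_add_le (z - c) c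
      have h5 : R + K / (1 + a) = K := by rw [hR]; field_simp; ring
      linarith
    simp only [hψ, indicator_of_mem hz, indicator_of_mem hzK]
    rw [← Real.exp_add, ← Real.exp_add]
    apply le_of_eq
    congr 1
    rw [norm_smul, Real.norm_of_nonneg hs.le, mul_pow, hsq, norm_sub_sq_real, norm_sub_sq_real,
      hc, norm_smul, Real.norm_of_nonneg (by positivity), inner_smul_right, real_inner_comm]
    field_simp
    ring
  · simp only [hψ, indicator_of_notMem hz, mul_zero]
    exact hrhs

/-- Scaling by `κ` on the orthogonal complement of `e`, identity along `e`. -/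
def axialMap (e : EuclideanSpace ℝ (Fin n)) (κ : ℝ) :
    EuclideanSpace ℝ (Fin n) →ₗ[ℝ] EuclideanSpace ℝ (Fin n) :=
  κ • LinearMap.transvection (((1 - κ) / κ) • innerₛₗ ℝ e) e

lemma det_axialMap (hn : 0 < n) {e : EuclideanSpace ℝ (Fin n)} (he : ‖e‖ = 1) {κ : ℝ}
    (hκ : 0 < κ) : LinearMap.det (axialMap e κ) = κ ^ (n - 1) := by
  obtain ⟨k, rfl⟩ : ∃ k, n = k + 1 := ⟨n - 1, by omega⟩
  have : (innerₛₗ ℝ e) e = 1 := by simp [he]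
  rw [axialMap, LinearMap.det_smul, LinearMap.transvection.det, finrank_euclideanSpace_fin,
    LinearMap.smul_apply, this]
  simp only [smul_eq_mul, Nat.add_sub_cancel]
  field_simp
  ring

lemma norm_axialMap_sq {e : EuclideanSpace ℝ (Fin n)} (he : ‖e‖ = 1) {κ : ℝ}
    (hκ : 0 < κ) (w : EuclideanSpace ℝ (Fin n)) :
    ‖axialMap e κ w‖ ^ 2 = ⟪e, w⟫ ^ 2 + κ ^ 2 * (‖w‖ ^ 2 - ⟪e, w⟫ ^ 2) := by
  rw [axialMap, LinearMap.smul_apply, LinearMap.transvection.apply, norm_smul, mul_pow,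
    norm_add_sq_real]
  simp only [LinearMap.smul_apply, innerₛₗ_apply_apply, smul_eq_mul, norm_smul, he, mul_one,
    inner_smul_right, real_inner_comm e w, Real.norm_eq_abs, sq_abs]
  field_simp
  ring

end Gaussian

section LowerBound

variable {n : ℕ} {p : EuclideanSpace ℝ (Fin n) → ℝ}

/-- Lower bound for convolution powers of a density dominating a Gaussian on a ball around `ρ`:
compare with a Gaussian random walk whose partial sums stay in a ball. -/
lemma le_convPow (hp0 : ∀ y, 0 ≤ p y)
    {T : EuclideanSpace ℝ (Fin n) →ₗ[ℝ] EuclideanSpace ℝ (Fin n)} (hT : LinearMap.det T ≠ 0)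
    {ρ : EuclideanSpace ℝ (Fin n)} {a K : ℝ} (ha : 0 < a) (hK : 0 ≤ K)
    (hpT : ∀ w, ‖T w‖ ≤ 2 * K → Real.exp (-‖T w‖ ^ 2 / 2) ≤ p (ρ + w))
    (hconv : ∀ (m : ℕ) v, ‖T v‖ ≤ K →
      Integrable fun y => convPow n p m (((m : ℝ) + 2) • ρ + v - y) * p y) (m : ℕ) :
    ∀ v, ‖T v‖ ≤ K →
      (√((m : ℝ) + 1) ^ n)⁻¹ *
        ((√(1 + a) ^ n)⁻¹ * |LinearMap.det T|⁻¹ * gaussBall n (K * (a / (1 + a)))) ^ m *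
        Real.exp (-((1 / ((m : ℝ) + 1) + a) * ‖T v‖ ^ 2) / 2)
      ≤ convPow n p m (((m : ℝ) + 1) • ρ + v) := by
  set Γ := gaussBall n (K * (a / (1 + a))) with hΓ
  have hΓ0 : 0 ≤ Γ := gaussBall_nonneg _
  set Λ := (√(1 + a) ^ n)⁻¹ * |LinearMap.det T|⁻¹ * Γ with hΛ
  have hΛ0 : 0 ≤ Λ := by positivity
  induction m with
  | zero =>
    intro v hv
    have h := hpT v (by linarith)
    simp only [convPow, CharP.cast_eq_zero, zero_add, Real.sqrt_one, one_pow, inv_one, pow_zero,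
      one_mul, one_smul, div_one]
    refine le_trans (Real.exp_le_exp.2 ?_) h
    have : 0 ≤ a * ‖T v‖ ^ 2 := by positivity
    linarith
  | succ m ih =>
    intro v hv
    set A : ℝ := 1 / ((m : ℝ) + 1) + a with hA
    have hm0 : (0 : ℝ) < (m : ℝ) + 1 := by positivity
    have hA0 : 0 < A := by positivity
    set C := (√((m : ℝ) + 1) ^ n)⁻¹ * Λ ^ m with hC
    have hC0 : 0 ≤ C := by positivity
    have hBm : MeasurableSet (Metric.closedBall (0 : EuclideanSpace ℝ (Fin n)) K) :=
      Metric.isClosed_closedBall.measurableSet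
    set φ : EuclideanSpace ℝ (Fin n) → ℝ := (Metric.closedBall 0 K).indicator fun z =>
      Real.exp (-(A * ‖z‖ ^ 2) / 2) * Real.exp (-‖T v - z‖ ^ 2 / 2) with hφ
    have hφi : Integrable φ := by
      rw [hφ, integrable_indicator_iff hBm]
      refine ContinuousOn.integrableOn_compact (isCompact_closedBall _ _) ?_
      fun_prop
    have hi := hconv m v hv
    have key : C * ∫ z, φ (T z) ≤ convPow n p (m + 1) (((m : ℝ) + 2) • ρ + v) := by
      have hcoe : convPow n p (m + 1) (((m : ℝ) + 2) • ρ + v)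
          = ∫ y, convPow n p m (((m : ℝ) + 2) • ρ + v - y) * p y := rfl
      rw [hcoe, ← integral_sub_left_eq_self
        (fun y => convPow n p m (((m : ℝ) + 2) • ρ + v - y) * p y) volume (ρ + v),
      ← integral_const_mul]
      refine integral_mono ((integrable_comp_linearMap T hT hφi).const_mul C)
        (hi.comp_sub_left (ρ + v)) fun z => ?_
      have hxz : ((m : ℝ) + 2) • ρ + v - (ρ + v - z) = ((m : ℝ) + 1) • ρ + z := by
        module
      have hyz : ρ + v - z = ρ + (v - z) := by abel
      simp only [hxz]
      rw [hyz]
      by_cases hz : T z ∈ Metric.closedBall (0 : EuclideanSpace ℝ (Fin n)) K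
      · simp only [hφ, indicator_of_mem hz]
        rw [mem_closedBall_zero_iff] at hz
        rw [← mul_assoc]
        refine mul_le_mul (ih z hz) ?_ (Real.exp_pos _).le (convPow_nonneg hp0 _ _)
        rw [← map_sub]
        refine hpT _ ?_
        rw [map_sub]
        linarith [norm_sub_le (T v) (T z)]
      · simp only [hφ, indicator_of_notMem hz, mul_zero]
        exact mul_nonneg (convPow_nonneg hp0 _ _) (hp0 _)
    rw [integral_comp_linearMap T hT, hφ, integral_indicator hBm] at key
    have hstep := gaussian_step ha (show a ≤ A by rw [hA]; linarith [one_div_pos.2 hm0]) hK hv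
    push_cast
    have h2 : (m : ℝ) + 1 + 1 = m + 2 := by ring
    rw [h2]
    refine le_trans ?_ key
    have hdet : 0 ≤ |LinearMap.det T|⁻¹ := by positivity
    refine le_trans ?_
      (mul_le_mul_of_nonneg_left (mul_le_mul_of_nonneg_left hstep hdet) hC0)
    have hexp : Real.exp (-((1 / ((m : ℝ) + 2) + a) * ‖T v‖ ^ 2) / 2)
        ≤ Real.exp (-(A / (1 + A) * ‖T v‖ ^ 2) / 2) := by
      have hq : A / (1 + A) ≤ 1 / ((m : ℝ) + 2) + a := by
        rw [div_le_iff₀ (by positivity), hA]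
        have : (1 / ((m : ℝ) + 2) + a) * (1 + (1 / ((m : ℝ) + 1) + a)) -
            (1 / ((m : ℝ) + 1) + a) =
              1 / ((m : ℝ) + 2) * a + a * (1 / ((m : ℝ) + 1) + a) := by
          field_simp
          ring
        have : 0 ≤ 1 / ((m : ℝ) + 2) * a + a * (1 / ((m : ℝ) + 1) + a) := by positivity
        linarith
      apply Real.exp_le_exp.2
      have := mul_le_mul_of_nonneg_right hq (sq_nonneg ‖T v‖)
      linarith
    have hsqrt : (√((m : ℝ) + 2) ^ n)⁻¹ * (√(1 + a) ^ n)⁻¹ ≤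
        (√((m : ℝ) + 1) ^ n)⁻¹ * (√(1 + A) ^ n)⁻¹ := by
      rw [← mul_inv, ← mul_inv, ← mul_pow, ← mul_pow]
      refine inv_anti₀ (by positivity) ?_
      refine pow_le_pow_left₀ (by positivity) ?_ n
      rw [← Real.sqrt_mul (by positivity), ← Real.sqrt_mul (by positivity)]
      apply Real.sqrt_le_sqrt
      rw [hA]
      have : ((m : ℝ) + 1) * (1 + (1 / ((m : ℝ) + 1) + a)) = m + 2 + (m + 1) * a := by
        field_simp
        ring
      rw [this]
      nlinarith
    calc (√((m : ℝ) + 2) ^ n)⁻¹ * Λ ^ (m + 1) *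
          Real.exp (-((1 / ((m : ℝ) + 2) + a) * ‖T v‖ ^ 2) / 2)
        = (√((m : ℝ) + 2) ^ n)⁻¹ * (√(1 + a) ^ n)⁻¹ * (Λ ^ m * |LinearMap.det T|⁻¹ * Γ) *
          Real.exp (-((1 / ((m : ℝ) + 2) + a) * ‖T v‖ ^ 2) / 2) := by rw [pow_succ, hΛ]; ring
      _ ≤ (√((m : ℝ) + 1) ^ n)⁻¹ * (√(1 + A) ^ n)⁻¹ * (Λ ^ m * |LinearMap.det T|⁻¹ * Γ) *
          Real.exp (-(A / (1 + A) * ‖T v‖ ^ 2) / 2) := by gcongr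
      _ = _ := by rw [hC]; ring

end LowerBound

section RegularVariation

lemma tangent_le {I : Set ℝ} (hI : Convex ℝ I) {g g' g'' : ℝ → ℝ}
    (h1 : ∀ x ∈ I, HasDerivAt g (g' x) x) (h2 : ∀ x ∈ I, HasDerivAt g' (g'' x) x)
    (h0 : ∀ x ∈ I, 0 ≤ g'' x) {r s : ℝ} (hr : r ∈ I) (hs : s ∈ I) :
    g r + g' r * (s - r) ≤ g s := by
  have hc : ConvexOn ℝ I g := convexOn_of_hasDerivWithinAt2_nonneg hI
    (fun x hx => (h1 x hx).continuousAt.continuousWithinAt)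
    (fun x hx => (h1 x (interior_subset hx)).hasDerivWithinAt)
    (fun x hx => (h2 x (interior_subset hx)).hasDerivWithinAt)
    (fun x hx => h0 x (interior_subset hx))
  rcases lt_trichotomy r s with h | rfl | h
  · have := hc.le_slope_of_hasDerivAt hr hs h (h1 r hr)
    rw [slope_def_field, le_div_iff₀ (by linarith)] at this
    linarith
  · simp
  · have := hc.slope_le_of_hasDerivAt hs hr h (h1 r hr)
    rw [slope_def_field, div_le_iff₀ (by linarith)] at this
    linarith

variable {α : ℝ} {f : ℝ → ℝ}

/-- Smooth regular variation in terms of the first two derivatives. -/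
lemma SmoothRegVary.tendsto_deriv (hf : SmoothRegVary α f) :
    (∃ z : ℝ, ∀ s, z < s → 0 < f s ∧ HasDerivAt f (deriv f s) s ∧
      HasDerivAt (deriv f) (deriv (deriv f) s) s) ∧
    Tendsto (fun s => s * deriv f s / f s) atTop (𝓝 α) ∧
    Tendsto (fun s => s ^ 2 * deriv (deriv f) s / f s) atTop (𝓝 (α * (α - 1))) := by
  obtain ⟨z, hz1, hpos, hsm, ht1, ht2⟩ := hf
  have hd := (contDiffOn_infty_iff_deriv_of_isOpen isOpen_Ioi).1 hsm
  have hd2 := (contDiffOn_infty_iff_deriv_of_isOpen isOpen_Ioi).1 hd.2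
  have D1 : ∀ s, z < s → HasDerivAt f (deriv f s) s := fun s hs =>
    ((hd.1 s hs).differentiableAt (Ioi_mem_nhds hs)).hasDerivAt
  have D2 : ∀ s, z < s → HasDerivAt (deriv f) (deriv (deriv f) s) s := fun s hs =>
    ((hd2.1 s hs).differentiableAt (Ioi_mem_nhds hs)).hasDerivAt
  have hz0 : 0 < z := by linarith
  have hexp : ∀ u, Real.log z < u → z < Real.exp u := fun u hu => (Real.log_lt_iff_lt_exp hz0).1 hu
  have E1 : ∀ u, Real.log z < u → deriv (fun u => Real.log (f (Real.exp u))) u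
      = Real.exp u * deriv f (Real.exp u) / f (Real.exp u) := by
    intro u hu
    have h := ((D1 _ (hexp u hu)).comp u (Real.hasDerivAt_exp u)).log (hpos _ (hexp u hu)).ne'
    refine h.deriv.trans ?_
    simp only [Function.comp]
    ring
  have E2 : ∀ u, Real.log z < u →
      iteratedDeriv 2 (fun u => Real.log (f (Real.exp u))) u
      = Real.exp u * deriv f (Real.exp u) / f (Real.exp u)
        + Real.exp u ^ 2 * deriv (deriv f) (Real.exp u) / f (Real.exp u)
        - (Real.exp u * deriv f (Real.exp u) / f (Real.exp u)) ^ 2 := by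
    intro u hu
    have hne := (hpos _ (hexp u hu)).ne'
    rw [iteratedDeriv_succ, iteratedDeriv_one]
    have hev : deriv (fun u => Real.log (f (Real.exp u))) =ᶠ[𝓝 u]
        fun u => Real.exp u * deriv f (Real.exp u) / f (Real.exp u) := by
      filter_upwards [Ioi_mem_nhds hu] with v hv using E1 v hv
    rw [hev.deriv_eq]
    have hA := (Real.hasDerivAt_exp u).mul ((D2 _ (hexp u hu)).comp u (Real.hasDerivAt_exp u))
    have hB := (D1 _ (hexp u hu)).comp u (Real.hasDerivAt_exp u)
    refine (hA.div hB hne).deriv.trans ?_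
    simp only [Function.comp]
    field_simp
    simp only [Pi.mul_apply, Function.comp]
    ring
  have T1 : Tendsto (fun u => Real.exp u * deriv f (Real.exp u) / f (Real.exp u)) atTop
      (𝓝 α) := by
    refine ht1.congr' ?_
    filter_upwards [eventually_gt_atTop (Real.log z)] with u hu using E1 u hu
  have T2 : Tendsto (fun u => Real.exp u ^ 2 * deriv (deriv f) (Real.exp u) / f (Real.exp u))
      atTop (𝓝 (α * (α - 1))) := by
    have := ((ht2 2 le_rfl).sub T1).add (T1.pow 2)
    have e : (0 : ℝ) - α + α ^ 2 = α * (α - 1) := by ring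
    rw [e] at this
    refine this.congr' ?_
    filter_upwards [eventually_gt_atTop (Real.log z)] with u hu
    rw [E2 u hu]
    ring
  refine ⟨⟨z, fun s hs => ⟨hpos s hs, D1 s hs, D2 s hs⟩⟩, ?_, ?_⟩
  · refine (T1.comp Real.tendsto_log_atTop).congr' ?_
    filter_upwards [eventually_gt_atTop 0] with s hs
    simp [Real.exp_log hs]
  · refine (T2.comp Real.tendsto_log_atTop).congr' ?_
    filter_upwards [eventually_gt_atTop 0] with s hs
    simp [Real.exp_log hs]

/-- The properties of a smoothly regularly varying function of index `α > 1` beyond a suitable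
threshold `z`. -/
structure RegVaryBeyond (α : ℝ) (f : ℝ → ℝ) (z : ℝ) : Prop where
  one_le : 1 ≤ z
  pos : ∀ s, z < s → 0 < f s
  hasDerivAt : ∀ s, z < s → HasDerivAt f (deriv f s) s
  hasDerivAt_deriv : ∀ s, z < s → HasDerivAt (deriv f) (deriv (deriv f) s) s
  deriv_pos : ∀ s, z < s → 0 < deriv f s
  deriv2_pos : ∀ s, z < s → 0 < deriv (deriv f) s
  le_deriv : ∀ s, z < s → (α + 1) / 2 * f s ≤ s * deriv f s
  deriv_le : ∀ s, z < s → s * deriv f s ≤ (α + 1) * f s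
  le_deriv2 : ∀ s, z < s → α * (α - 1) / 2 * f s ≤ s ^ 2 * deriv (deriv f) s
  deriv2_le : ∀ s, z < s → s ^ 2 * deriv (deriv f) s ≤ 2 * (α * (α - 1)) * f s

lemma SmoothRegVary.exists_beyond (hα : 1 < α) (hf : SmoothRegVary α f) :
    ∃ z, RegVaryBeyond α f z := by
  obtain ⟨⟨z, hz⟩, T1, T2⟩ := hf.tendsto_deriv
  have hc : 0 < α * (α - 1) := mul_pos (by linarith) (by linarith)
  have e := ((((T1.eventually (lt_mem_nhds (show (α + 1) / 2 < α by linarith))).and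
    (T1.eventually (gt_mem_nhds (show α < α + 1 by linarith)))).and
    ((T2.eventually (lt_mem_nhds (show α * (α - 1) / 2 < α * (α - 1) by linarith))).and
    (T2.eventually (gt_mem_nhds (show α * (α - 1) < 2 * (α * (α - 1)) by linarith)))))).and
    (eventually_gt_atTop z)
  obtain ⟨R, hR⟩ := eventually_atTop.1 e
  have hR' : ∀ s, max R 1 < s → _ := fun s hs => hR s ((le_max_left _ _).trans hs.le)
  have hs0 : ∀ s, max R 1 < s → 0 < s := fun s hs =>
    zero_lt_one.trans ((le_max_right R 1).trans_lt hs)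
  have P : ∀ s, max R 1 < s → 0 < f s := fun s hs => (hz s (hR' s hs).2).1
  have L1 : ∀ s, max R 1 < s → (α + 1) / 2 * f s ≤ s * deriv f s := fun s hs =>
    ((lt_div_iff₀ (P s hs)).1 (hR' s hs).1.1.1).le
  have L2 : ∀ s, max R 1 < s → α * (α - 1) / 2 * f s ≤ s ^ 2 * deriv (deriv f) s := fun s hs =>
    ((lt_div_iff₀ (P s hs)).1 (hR' s hs).1.2.1).le
  exact ⟨max R 1,
    { one_le := le_max_right _ _
      pos := P
      hasDerivAt := fun s hs => (hz s (hR' s hs).2).2.1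
      hasDerivAt_deriv := fun s hs => (hz s (hR' s hs).2).2.2
      deriv_pos := fun s hs => by
        have := (mul_pos (show 0 < (α + 1) / 2 by linarith) (P s hs)).trans_le (L1 s hs)
        exact pos_of_mul_pos_right this (hs0 s hs).le
      deriv2_pos := fun s hs => by
        have := (mul_pos (half_pos hc) (P s hs)).trans_le (L2 s hs)
        exact pos_of_mul_pos_right this (sq_nonneg s)
      le_deriv := L1
      deriv_le := fun s hs => ((div_lt_iff₀ (P s hs)).1 (hR' s hs).1.1.2).le
      le_deriv2 := L2
      deriv2_le := fun s hs => ((div_lt_iff₀ (P s hs)).1 (hR' s hs).1.2.2).le }⟩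

namespace RegVaryBeyond

variable {z : ℝ}

lemma tangent (h : RegVaryBeyond α f z) {r s : ℝ} (hr : z < r) (hs : z < s) :
    f r + deriv f r * (s - r) ≤ f s :=
  tangent_le (convex_Ioi z) h.hasDerivAt h.hasDerivAt_deriv
    (fun x hx => (h.deriv2_pos x hx).le) hr hs

lemma tendsto (h : RegVaryBeyond α f z) : Tendsto f atTop atTop := by
  have h1 : z < z + 1 := by linarith
  have : Tendsto (fun s => f (z + 1) + deriv f (z + 1) * (s - (z + 1))) atTop atTop :=
    tendsto_atTop_add_const_left _ _ ((tendsto_atTop_add_const_right _ _ tendsto_id).const_mul_atTop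
      (h.deriv_pos _ h1))
  refine tendsto_atTop_mono' _ ?_ this
  filter_upwards [eventually_gt_atTop z] with s hs using h.tangent h1 hs

/-- The second derivative is nearly constant on multiplicatively small intervals. -/
lemma deriv2_near (h : RegVaryBeyond α f z) (hα : 1 < α)
    (hT : Tendsto (fun s => s ^ 2 * deriv (deriv f) s / f s) atTop (𝓝 (α * (α - 1))))
    {ε : ℝ} (hε : 0 < ε) :
    ∃ η > 0, η ≤ 1 / 2 ∧ ∃ R, 2 * z ≤ R ∧ ∀ r, R < r → ∀ s, |s - r| ≤ η * r →
      (1 - ε) * deriv (deriv f) r ≤ deriv (deriv f) s ∧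
      deriv (deriv f) s ≤ (1 + ε) * deriv (deriv f) r := by
  have hc : 0 < α * (α - 1) := mul_pos (by linarith) (by linarith)
  set κ := Real.log (1 + ε) with hκ
  have hκ0 : 0 < κ := Real.log_pos (by linarith)
  have hz1 := h.one_le
  have hTl : Tendsto (fun s => Real.log (s ^ 2 * deriv (deriv f) s / f s)) atTop
      (𝓝 (Real.log (α * (α - 1)))) := hT.log hc.ne'
  obtain ⟨R₀, hR₀⟩ := eventually_atTop.1 (Metric.tendsto_nhds.1 hTl (κ / 4) (by linarith))
  set η := min (1 / 2) (κ / (4 * (α + 3))) with hη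
  have hη0 : 0 < η := by positivity
  have hη2 : η ≤ 1 / 2 := min_le_left _ _
  have hη3 : η * (4 * (α + 3)) ≤ κ := (le_div_iff₀ (by linarith)).1 (min_le_right _ _)
  refine ⟨η, hη0, hη2, max (2 * z) (2 * R₀), le_max_left _ _, fun r hr s hs => ?_⟩
  have hr1 : 2 * z < r := (le_max_left _ _).trans_lt hr
  have hr2 : 2 * R₀ < r := (le_max_right _ _).trans_lt hr
  have hr0 : 0 < r := by linarith
  have hI : ∀ x ∈ Set.Icc (r - η * r) (r + η * r), r / 2 ≤ x := by
    intro x hx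
    have := mul_le_mul_of_nonneg_right hη2 hr0.le
    linarith [hx.1]
  have hrI : r ∈ Set.Icc (r - η * r) (r + η * r) := by
    have := mul_pos hη0 hr0
    constructor <;> linarith
  have hsI : s ∈ Set.Icc (r - η * r) (r + η * r) := by
    rw [abs_le] at hs
    constructor <;> linarith [hs.1, hs.2]
  have hs2 := hI s hsI
  have hs0 : 0 < s := by linarith
  have hlogf : |Real.log (f s) - Real.log (f r)| ≤ 2 * (α + 1) / r * |s - r| := by
    refine Convex.norm_image_sub_le_of_norm_hasDerivWithin_le
      (f := fun x => Real.log (f x)) (f' := fun x => deriv f x / f x)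
      (s := Set.Icc (r - η * r) (r + η * r)) (fun x hx => ?_) (fun x hx => ?_)
      (convex_Icc _ _) hrI hsI
    · have hx := hI x hx
      exact ((h.hasDerivAt x (by linarith)).log (h.pos x (by linarith)).ne').hasDerivWithinAt
    · have hx := hI x hx
      have hzx : z < x := by linarith
      have hf := h.pos x hzx
      have hd := h.deriv_pos x hzx
      have := h.deriv_le x hzx
      rw [Real.norm_of_nonneg (by positivity), div_le_div_iff₀ hf hr0]
      nlinarith
  have hlogs : |Real.log s - Real.log r| ≤ 2 / r * |s - r| := by
    refine Convex.norm_image_sub_le_of_norm_hasDerivWithin_le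
      (f := Real.log) (f' := fun x => x⁻¹)
      (s := Set.Icc (r - η * r) (r + η * r)) (fun x hx => ?_) (fun x hx => ?_)
      (convex_Icc _ _) hrI hsI
    · have hx := hI x hx
      exact (Real.hasDerivAt_log (by linarith)).hasDerivWithinAt
    · have hx := hI x hx
      rw [Real.norm_of_nonneg (inv_nonneg.2 (by linarith)), inv_eq_one_div,
        div_le_div_iff₀ (by linarith) hr0]
      linarith
  have hcl : ∀ c : ℝ, 0 ≤ c → c / r * |s - r| ≤ c * η := by
    intro c hc
    calc c / r * |s - r| ≤ c / r * (η * r) := by gcongr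
      _ = c * η := by field_simp
  have hdec : ∀ x, z < x → Real.log (x ^ 2 * deriv (deriv f) x / f x)
      = 2 * Real.log x + Real.log (deriv (deriv f) x) - Real.log (f x) := by
    intro x hx
    have hx0 : 0 < x := by linarith
    have h2 := h.deriv2_pos x hx
    rw [Real.log_div (by positivity) (h.pos x hx).ne', Real.log_mul (by positivity) h2.ne',
      Real.log_pow]
    norm_num
  have hzs : z < s := by linarith
  have hzr : z < r := by linarith
  have hs' := hR₀ s (by linarith)
  have hr' := hR₀ r (by linarith)
  rw [Real.dist_eq, hdec s hzs] at hs'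
  rw [Real.dist_eq, hdec r hzr] at hr'
  have h1 := hlogf.trans (hcl (2 * (α + 1)) (by linarith))
  have h2 := hlogs.trans (hcl 2 (by norm_num))
  have hDs := h.deriv2_pos s hzs
  have hDr := h.deriv2_pos r hzr
  rw [abs_lt] at hs' hr'
  rw [abs_le] at h1 h2
  have hup : Real.log (deriv (deriv f) s) ≤ κ + Real.log (deriv (deriv f) r) := by
    nlinarith [hs'.1, hs'.2, hr'.1, hr'.2, h1.1, h1.2, h2.1, h2.2]
  have hlo : Real.log (deriv (deriv f) r) ≤ κ + Real.log (deriv (deriv f) s) := by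
    nlinarith [hs'.1, hs'.2, hr'.1, hr'.2, h1.1, h1.2, h2.1, h2.2]
  rw [hκ, ← Real.log_mul (by linarith) hDr.ne', Real.log_le_log_iff hDs (by positivity)] at hup
  rw [hκ, ← Real.log_mul (by linarith) hDs.ne', Real.log_le_log_iff hDr (by positivity)] at hlo
  refine ⟨?_, hup⟩
  rcases le_or_gt 1 ε with h1 | h1
  · nlinarith
  · have := mul_le_mul_of_nonneg_left hlo (show 0 ≤ 1 - ε by linarith)
    nlinarith

/-- Second-order Taylor bounds, and linear growth of the remainder far away. -/
lemma taylor (h : RegVaryBeyond α f z) {r η ε : ℝ} (hη : 0 < η) (hη2 : η ≤ 1 / 2)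
    (hr : 2 * z < r)
    (hD : ∀ s, |s - r| ≤ η * r → (1 - ε) * deriv (deriv f) r ≤ deriv (deriv f) s ∧
      deriv (deriv f) s ≤ (1 + ε) * deriv (deriv f) r) :
    (∀ s, |s - r| ≤ η * r →
      (1 - ε) * deriv (deriv f) r * (s - r) ^ 2 / 2 ≤ f s - f r - deriv f r * (s - r) ∧
      f s - f r - deriv f r * (s - r) ≤ (1 + ε) * deriv (deriv f) r * (s - r) ^ 2 / 2) ∧
    ∀ s, z < s → η * r ≤ |s - r| →
      (1 - ε) * deriv (deriv f) r * (η * r) * |s - r| / 2 ≤ f s - f r - deriv f r * (s - r) := by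
  have hz1 := h.one_le
  have hr0 : 0 < r := by linarith
  have hzr : z < r := by linarith
  have hηr : 0 < η * r := mul_pos hη hr0
  have hηr2 := mul_le_mul_of_nonneg_right hη2 hr0.le
  set D := deriv (deriv f) r with hDdef
  have near : ∀ s, |s - r| ≤ η * r →
      (1 - ε) * D * (s - r) ^ 2 / 2 ≤ f s - f r - deriv f r * (s - r) ∧
      f s - f r - deriv f r * (s - r) ≤ (1 + ε) * D * (s - r) ^ 2 / 2 := by
    intro s hs
    have hI : ∀ x ∈ Set.Icc (r - η * r) (r + η * r), |x - r| ≤ η * r ∧ z < x := by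
      intro x hx
      exact ⟨abs_le.2 ⟨by linarith [hx.1], by linarith [hx.2]⟩, by linarith [hx.1]⟩
    have hrI : r ∈ Set.Icc (r - η * r) (r + η * r) := by constructor <;> linarith
    have hsI : s ∈ Set.Icc (r - η * r) (r + η * r) := by
      rw [abs_le] at hs
      constructor <;> linarith [hs.1, hs.2]
    have dq : ∀ (c x : ℝ), HasDerivAt (fun x => c * (x - r) ^ 2 / 2) (c * (x - r)) x := by
      intro c x
      have := ((((hasDerivAt_id x).sub_const r).pow 2).const_mul c).div_const 2
      refine this.congr_deriv ?_
      simp only [id]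
      push_cast
      ring
    have dl : ∀ (c x : ℝ), HasDerivAt (fun x => c * (x - r)) c x := by
      intro c x
      simpa using ((hasDerivAt_id x).sub_const r).const_mul c
    have k1 := tangent_le (convex_Icc (r - η * r) (r + η * r))
      (g := fun x => f x - (1 - ε) * D * (x - r) ^ 2 / 2)
      (g' := fun x => deriv f x - (1 - ε) * D * (x - r))
      (g'' := fun x => deriv (deriv f) x - (1 - ε) * D)
      (fun x hx => (h.hasDerivAt x (hI x hx).2).sub (dq _ x))
      (fun x hx => (h.hasDerivAt_deriv x (hI x hx).2).sub (dl _ x))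
      (fun x hx => sub_nonneg.2 (hD x (hI x hx).1).1) hrI hsI
    have k2 := tangent_le (convex_Icc (r - η * r) (r + η * r))
      (g := fun x => (1 + ε) * D * (x - r) ^ 2 / 2 - f x)
      (g' := fun x => (1 + ε) * D * (x - r) - deriv f x)
      (g'' := fun x => (1 + ε) * D - deriv (deriv f) x)
      (fun x hx => (dq _ x).sub (h.hasDerivAt x (hI x hx).2))
      (fun x hx => (dl _ x).sub (h.hasDerivAt_deriv x (hI x hx).2))
      (fun x hx => sub_nonneg.2 (hD x (hI x hx).1).2) hrI hsI
    simp only [sub_self, mul_zero, zero_pow, ne_eq, OfNat.ofNat_ne_zero, not_false_eq_true,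
      zero_div, sub_zero, zero_sub] at k1 k2
    constructor <;> linarith
  refine ⟨near, fun s hs hsr => ?_⟩
  have hsr0 : 0 < |s - r| := hηr.trans_le hsr
  set l := η * r / |s - r| with hl
  have hl0 : 0 < l := by positivity
  have hl1 : l ≤ 1 := (div_le_one hsr0).2 hsr
  set q := r + l * (s - r) with hq
  have hqr : |q - r| = η * r := by
    rw [hq, add_sub_cancel_left, abs_mul, abs_of_pos hl0, hl]
    field_simp
  have hzq : z < q := by
    have := (abs_le.1 hqr.le).1
    linarith
  have hn := (near q hqr.le).1
  rw [← sq_abs, hqr] at hn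
  have c1 := h.tangent hzq hs
  have c2 := h.tangent hzq hzr
  have e1 : s - q = (1 - l) * (s - r) := by rw [hq]; ring
  have e2 : r - q = -(l * (s - r)) := by rw [hq]; ring
  have e3 : q - r = l * (s - r) := by rw [hq]; ring
  rw [e1] at c1
  rw [e2] at c2
  rw [e3] at hn
  have c3 : f q ≤ l * f s + (1 - l) * f r := by nlinarith
  have e4 : l * |s - r| = η * r := by rw [hl]; field_simp
  have c4 : l * ((1 - ε) * D * (η * r) * |s - r| / 2) ≤
      l * (f s - f r - deriv f r * (s - r)) := by
    calc l * ((1 - ε) * D * (η * r) * |s - r| / 2)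
        = (1 - ε) * D * (η * r) ^ 2 / 2 := by rw [← e4]; ring
      _ ≤ f q - f r - deriv f r * (l * (s - r)) := hn
      _ ≤ _ := by linarith
  exact le_of_mul_le_mul_left c4 hl0

end RegVaryBeyond

end RegularVariation

section Geometry

variable {α : ℝ} {f : ℝ → ℝ} {z : ℝ}

/-- Planar geometry: `s` is the length of a vector at distance `W` from a vector of length `r`,
`a` is the component of the difference along the latter, and `s - (r + a)` is the excess of the
length over the projection. -/
lemma sub_axial_bounds {r η s a W : ℝ} (hr0 : 0 < r) (hη : 0 < η) (hη2 : η ≤ 1 / 2)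
    (hs2 : s ^ 2 = r ^ 2 + 2 * r * a + W ^ 2) (haW : |a| ≤ W)
    (hsr : |s - r| ≤ W) (hW : W ≤ η * r) :
    0 ≤ s - (r + a) ∧ 0 ≤ W ^ 2 - a ^ 2 ∧
    (1 - η) * (W ^ 2 - a ^ 2) ≤ 2 * (r * (s - (r + a))) ∧
    2 * (r * (s - (r + a))) ≤ (1 + 2 * η) * (W ^ 2 - a ^ 2) ∧
    (1 - η) * a ^ 2 - η * (W ^ 2 - a ^ 2) ≤ (s - r) ^ 2 ∧
    (s - r) ^ 2 ≤ (1 + η) * a ^ 2 + 2 * η * (W ^ 2 - a ^ 2) := by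
  obtain ⟨ha1, ha2⟩ := abs_le.1 haW
  obtain ⟨hs1, hs3⟩ := abs_le.1 hsr
  obtain ⟨P, hP⟩ : ∃ P, P = W ^ 2 - a ^ 2 := ⟨_, rfl⟩
  obtain ⟨B, hB⟩ : ∃ B, B = s - (r + a) := ⟨_, rfl⟩
  have hP0 : 0 ≤ P := by
    rw [hP, sub_nonneg]
    exact sq_le_sq' ha1 ha2
  have hPB : P = B * (s + (r + a)) := by
    rw [hP, hB]
    linarith [show (s - (r + a)) * (s + (r + a)) = s ^ 2 - r ^ 2 - 2 * r * a - a ^ 2 by ring]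
  have hL : 2 * (1 - η) * r ≤ s + (r + a) := by linarith
  have hU : s + (r + a) ≤ 2 * (1 + η) * r := by linarith
  have hrL : r ≤ s + (r + a) := by nlinarith
  have hLpos : 0 < s + (r + a) := by linarith
  have hB0 : 0 ≤ B := by
    rw [hPB] at hP0
    exact nonneg_of_mul_nonneg_left hP0 hLpos
  have hrB0 : 0 ≤ r * B := mul_nonneg hr0.le hB0
  have hB1 : 2 * (1 - η) * (r * B) ≤ P := by
    have := mul_le_mul_of_nonneg_left hL hB0
    linarith
  have hB2 : P ≤ 2 * (1 + η) * (r * B) := by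
    have := mul_le_mul_of_nonneg_left hU hB0
    linarith
  have hrB : r * B ≤ P := by
    have := mul_le_mul_of_nonneg_left hrL hB0
    linarith
  have hPW : P ≤ (η * r) ^ 2 := by
    have : W ^ 2 ≤ (η * r) ^ 2 := pow_le_pow_left₀ (by linarith [abs_nonneg a]) hW 2
    linarith [sq_nonneg a]
  have hBB : B ^ 2 ≤ η ^ 2 * P := by
    have e1 : (r * B) ^ 2 ≤ P * (η * r) ^ 2 := by
      calc (r * B) ^ 2 ≤ P ^ 2 := pow_le_pow_left₀ hrB0 hrB 2
        _ = P * P := by ring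
        _ ≤ _ := mul_le_mul_of_nonneg_left hPW hP0
    have : r ^ 2 * B ^ 2 ≤ r ^ 2 * (η ^ 2 * P) := by linarith [e1]
    exact le_of_mul_le_mul_left this (by positivity)
  have hη2P : 0 ≤ η ^ 2 * P := by positivity
  have hsrB : s - r = a + B := by rw [hB]; ring
  rw [hsrB, ← hB, ← hP]
  refine ⟨hB0, hP0, ?_, ?_, ?_, ?_⟩
  · have := mul_le_mul_of_nonneg_left hB2 (show 0 ≤ 1 - η by linarith)
    linarith [mul_nonneg (sq_nonneg η) hrB0]
  · have := mul_le_mul_of_nonneg_left hB1 (show 0 ≤ 1 + 2 * η by linarith)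
    linarith [mul_nonneg (mul_nonneg hη.le (show 0 ≤ 1 - 2 * η by linarith)) hrB0]
  · have hc : η * ((1 - η) * a ^ 2 - η * P) ≤ η * (a + B) ^ 2 := by
      have k1 := mul_le_mul_of_nonneg_left hBB (show 0 ≤ 1 - η by linarith)
      linarith [sq_nonneg (η * a + B), mul_nonneg hη2P hη.le]
    exact le_of_mul_le_mul_left hc hη
  · have hc : η * ((a + B) ^ 2) ≤ η * ((1 + η) * a ^ 2 + 2 * η * P) := by
      have k1 := mul_le_mul_of_nonneg_left hBB (show 0 ≤ 1 + η by linarith)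
      linarith [sq_nonneg (η * a - B), mul_nonneg hη2P (show 0 ≤ 1 - η by linarith)]
    exact le_of_mul_le_mul_left hc hη

lemma RegVaryBeyond.excess_near (h : RegVaryBeyond α f z) (hα : 1 < α) {r η ε : ℝ} (hε : 0 < ε)
    (hε2 : ε ≤ 1 / 2) (hη : 0 < η) (hη2 : η ≤ 1 / 2) (hηε : η ≤ ε / 12)
    (hηα : η ≤ ε / 12 * (α - 1)⁻¹) (hr : 2 * z < r)
    (hψ : ∀ s, |s - r| ≤ η * r →
      (1 - ε / 3) * deriv (deriv f) r * (s - r) ^ 2 / 2 ≤ f s - f r - deriv f r * (s - r) ∧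
      f s - f r - deriv f r * (s - r) ≤ (1 + ε / 3) * deriv (deriv f) r * (s - r) ^ 2 / 2)
    (hd1 : (1 - ε / 3) * ((α - 1)⁻¹ * (deriv (deriv f) r * r)) ≤ deriv f r)
    (hd2 : deriv f r ≤ (1 + ε / 3) * ((α - 1)⁻¹ * (deriv (deriv f) r * r)))
    {s a W : ℝ} (hs2 : s ^ 2 = r ^ 2 + 2 * r * a + W ^ 2) (haW : |a| ≤ W)
    (hsr : |s - r| ≤ W) (hW : W ≤ η * r) :
    (1 - ε) * deriv (deriv f) r * (a ^ 2 + (α - 1)⁻¹ * (W ^ 2 - a ^ 2)) / 2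
        ≤ f s - f r - deriv f r * a ∧
      f s - f r - deriv f r * a
        ≤ (1 + ε) * deriv (deriv f) r * (a ^ 2 + (α - 1)⁻¹ * (W ^ 2 - a ^ 2)) / 2 := by
  obtain ⟨h1, h2⟩ := hψ s (hsr.trans hW)
  set D := deriv (deriv f) r with hD
  set β := (α - 1)⁻¹ with hβdef
  have hβ : 0 < β := inv_pos.2 (by linarith)
  have hz := h.one_le
  have hDpos : 0 < D := h.deriv2_pos r (by linarith)
  have hr0 : 0 < r := by linarith
  obtain ⟨hB0, hP0, h2rB', h2rB, hq2, hq1⟩ := sub_axial_bounds hr0 hη hη2 hs2 haW hsr hW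
  obtain ⟨P, hP⟩ : ∃ P, P = W ^ 2 - a ^ 2 := ⟨_, rfl⟩
  obtain ⟨B, hB⟩ : ∃ B, B = s - (r + a) := ⟨_, rfl⟩
  have hsrB : s - r = a + B := by rw [hB]; ring
  rw [← hP] at hP0 h2rB' h2rB hq2 hq1
  rw [← hB] at hB0 h2rB' h2rB
  have hE : f s - f r - deriv f r * a = (f s - f r - deriv f r * (s - r)) + deriv f r * B := by
    rw [hsrB]; ring
  have hβP : 0 ≤ β * P := mul_nonneg hβ.le hP0
  have hηP : η * P ≤ ε / 12 * (β * P) := by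
    calc η * P ≤ ε / 12 * β * P := mul_le_mul_of_nonneg_right hηα hP0
      _ = _ := by ring
  have hηβP : η * (β * P) ≤ ε / 12 * (β * P) := mul_le_mul_of_nonneg_right hηε hβP
  have hηa : η * a ^ 2 ≤ ε / 12 * a ^ 2 := mul_le_mul_of_nonneg_right hηε (sq_nonneg a)
  have hQ0 : 0 ≤ a ^ 2 + β * P := by positivity
  rw [hE, ← hP]
  constructor
  · have k1 : (1 - ε / 3) * (a ^ 2 + β * P) ≤ (s - r) ^ 2 + β * (2 * (r * B)) := by
      have := mul_le_mul_of_nonneg_left h2rB' hβ.le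
      linarith [mul_nonneg hε.le (sq_nonneg a), mul_nonneg hε.le hβP]
    have k2 : (1 - ε / 3) * D / 2 * ((1 - ε / 3) * (a ^ 2 + β * P))
        ≤ (1 - ε / 3) * D / 2 * ((s - r) ^ 2 + β * (2 * (r * B))) :=
      mul_le_mul_of_nonneg_left k1
        (half_pos (mul_pos (show 0 < 1 - ε / 3 by linarith) hDpos)).le
    have k3 : (1 - ε) * D * (a ^ 2 + β * P) / 2 ≤
        (1 - ε / 3) * D / 2 * ((1 - ε / 3) * (a ^ 2 + β * P)) := by
      have : (1 - ε) ≤ (1 - ε / 3) * (1 - ε / 3) := by linarith [sq_nonneg ε]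
      have := mul_le_mul_of_nonneg_right this (mul_nonneg hDpos.le hQ0)
      linarith
    have k4 := mul_le_mul_of_nonneg_right hd1 hB0
    linarith
  · have k1 : (s - r) ^ 2 + β * (2 * (r * B)) ≤ (1 + ε / 3) * (a ^ 2 + β * P) := by
      have := mul_le_mul_of_nonneg_left h2rB hβ.le
      linarith [mul_nonneg hε.le (sq_nonneg a), mul_nonneg hε.le hβP]
    have k2 : (1 + ε / 3) * D / 2 * ((s - r) ^ 2 + β * (2 * (r * B)))
        ≤ (1 + ε / 3) * D / 2 * ((1 + ε / 3) * (a ^ 2 + β * P)) :=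
      mul_le_mul_of_nonneg_left k1 (by positivity)
    have k3 : (1 + ε / 3) * D / 2 * ((1 + ε / 3) * (a ^ 2 + β * P)) ≤
        (1 + ε) * D * (a ^ 2 + β * P) / 2 := by
      have : (1 + ε / 3) * (1 + ε / 3) ≤ 1 + ε := by
        linarith [mul_nonneg hε.le (sub_nonneg.2 hε2)]
      have := mul_le_mul_of_nonneg_right this (mul_nonneg hDpos.le hQ0)
      linarith
    have k4 := mul_le_mul_of_nonneg_right hd2 hB0
    linarith

lemma RegVaryBeyond.excess_far (h : RegVaryBeyond α f z) (hα : 1 < α) {r η ε : ℝ}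
    (hε2 : ε ≤ 1 / 2) (hη : 0 < η) (hr : 2 * z < r)
    (hψ : ∀ s > z, η / 2 * r ≤ |s - r| →
      (1 - ε) * deriv (deriv f) r * (η / 2 * r) * |s - r| / 2
        ≤ f s - f r - deriv f r * (s - r))
    {s a W : ℝ} (hs2 : s ^ 2 = r ^ 2 + 2 * r * a + W ^ 2) (hsa : r + a ≤ s)
    (hW : η * r < W) (hsz : z < s) :
    min (η / 4) (α * (α - 1) * η / 32) * (f r / r) * W ≤ f s - f r - deriv f r * a := by
  have hz := h.one_le
  have hr0 : 0 < r := by linarith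
  have hrz : z < r := by linarith
  have hW0 : 0 < W := lt_trans (by positivity) hW
  have hf := h.pos r hrz
  have hd := h.deriv_pos r hrz
  have hfr : 0 < f r / r := by positivity
  have ht := h.tangent hrz hsz
  have hB0 : 0 ≤ s - (r + a) := by linarith
  have hE : f s - f r - deriv f r * a =
      (f s - f r - deriv f r * (s - r)) + deriv f r * (s - (r + a)) := by ring
  have hdB := mul_nonneg hd.le hB0
  rcases le_or_gt (W ^ 2) (4 * (r * (s - (r + a)))) with hc | hc
  · have hBW : η / 4 * W ≤ s - (r + a) := by
      have : r * (η / 4 * W) ≤ r * (s - (r + a)) := by nlinarith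
      exact le_of_mul_le_mul_left this hr0
    have hfd : f r / r ≤ deriv f r := by
      rw [div_le_iff₀ hr0]
      have := h.le_deriv r hrz
      nlinarith
    calc min (η / 4) (α * (α - 1) * η / 32) * (f r / r) * W
        ≤ η / 4 * (f r / r) * W := by gcongr; exact min_le_left _ _
      _ = f r / r * (η / 4 * W) := by ring
      _ ≤ deriv f r * (s - (r + a)) := by gcongr
      _ ≤ _ := by linarith
  · have hsr : (W / 2) ^ 2 ≤ (s - r) ^ 2 := by nlinarith
    have hsr' : W / 2 ≤ |s - r| := by
      rw [← abs_of_pos (show 0 < W / 2 by positivity)]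
      exact sq_le_sq.1 hsr
    have hk := hψ s hsz (by linarith)
    have hD := h.le_deriv2 r hrz
    have hDp := h.deriv2_pos r hrz
    have hDr : α * (α - 1) / 2 * (f r / r) ≤ deriv (deriv f) r * r := by
      rw [← mul_div_assoc, div_le_iff₀ hr0]
      linarith
    calc min (η / 4) (α * (α - 1) * η / 32) * (f r / r) * W
        ≤ α * (α - 1) * η / 32 * (f r / r) * W := by gcongr; exact min_le_right _ _
      _ = (1 / 2) * (α * (α - 1) / 2 * (f r / r)) * (η / 2) * (W / 2) / 2 := by ring
      _ ≤ (1 - ε) * (deriv (deriv f) r * r) * (η / 2) * |s - r| / 2 := by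
          have h1 : 0 ≤ α * (α - 1) / 2 * (f r / r) := by
            have : 0 ≤ α * (α - 1) := mul_nonneg (by linarith) (by linarith)
            positivity
          have h2 : (1 / 2) * (α * (α - 1) / 2 * (f r / r)) ≤
              (1 - ε) * (deriv (deriv f) r * r) :=
            mul_le_mul (by linarith) hDr h1 (by linarith)
          have h3 : 0 ≤ (1 - ε) * (deriv (deriv f) r * r) := le_trans (by positivity) h2
          gcongr
      _ = (1 - ε) * deriv (deriv f) r * (η / 2 * r) * |s - r| / 2 := by ring
      _ ≤ _ := by linarith

/-- The exponent of the density `exp (-f ‖·‖)` around the point `r • e`, after subtracting its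
affine part, is close to the quadratic form `f'' r * (⟪e, w⟫² + (α - 1)⁻¹ (‖w‖² - ⟪e, w⟫²)) / 2`
on a ball of radius proportional to `r`, and grows at least linearly outside. -/
lemma SmoothRegVary.exists_excess {n : ℕ} (hα : 1 < α) (hf : SmoothRegVary α f)
    (h : RegVaryBeyond α f z) {ε : ℝ} (hε : 0 < ε) (hε2 : ε ≤ 1 / 2) :
    ∃ η, 0 < η ∧ η ≤ 1 / 2 ∧ ∃ c, 0 < c ∧ ∃ R, 2 * z ≤ R ∧ ∀ r, R < r →
      ∀ e w : EuclideanSpace ℝ (Fin n), ‖e‖ = 1 →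
      (‖w‖ ≤ η * r →
        (1 - ε) * deriv (deriv f) r * (⟪e, w⟫ ^ 2 + (α - 1)⁻¹ * (‖w‖ ^ 2 - ⟪e, w⟫ ^ 2)) / 2
            ≤ f ‖r • e + w‖ - f r - deriv f r * ⟪e, w⟫ ∧
        f ‖r • e + w‖ - f r - deriv f r * ⟪e, w⟫
            ≤ (1 + ε) * deriv (deriv f) r *
              (⟪e, w⟫ ^ 2 + (α - 1)⁻¹ * (‖w‖ ^ 2 - ⟪e, w⟫ ^ 2)) / 2) ∧
      (η * r < ‖w‖ → z < ‖r • e + w‖ →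
        c * (f r / r) * ‖w‖ ≤ f ‖r • e + w‖ - f r - deriv f r * ⟪e, w⟫) := by
  obtain ⟨-, T1, T2⟩ := hf.tendsto_deriv
  have hα0 : 0 < α * (α - 1) := mul_pos (by linarith) (by linarith)
  have hβ : 0 < (α - 1)⁻¹ := inv_pos.2 (by linarith)
  obtain ⟨η₀, hη₀, hη₀2, R₀, hR₀z, hR₀⟩ := h.deriv2_near hα T2 (show 0 < ε / 3 by linarith)
  have T3 : Tendsto (fun s => deriv f s / (deriv (deriv f) s * s)) atTop (𝓝 (α - 1)⁻¹) := by
    have := T1.div T2 hα0.ne'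
    rw [show α / (α * (α - 1)) = (α - 1)⁻¹ by
      rw [div_mul_eq_div_div, div_self (by linarith), one_div]] at this
    refine this.congr' ?_
    filter_upwards [eventually_gt_atTop z] with s hs
    have := h.pos s hs
    have := h.deriv2_pos s hs
    have : 0 < s := by linarith [h.one_le]
    simp only [Pi.div_apply]
    field_simp
  obtain ⟨R₁, hR₁⟩ := eventually_atTop.1
    ((T3.eventually (lt_mem_nhds (show (1 - ε / 3) * (α - 1)⁻¹ < (α - 1)⁻¹ by nlinarith))).and
    (T3.eventually (gt_mem_nhds (show (α - 1)⁻¹ < (1 + ε / 3) * (α - 1)⁻¹ by nlinarith))))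
  set η := min η₀ (min (ε / 12) (ε / 12 * (α - 1)⁻¹)) with hηdef
  have hη : 0 < η := by positivity
  have hηη : η ≤ η₀ := min_le_left _ _
  refine ⟨η, hη, hηη.trans hη₀2, min (η / 4) (α * (α - 1) * η / 32), by positivity,
    max R₀ R₁, hR₀z.trans (le_max_left _ _), fun r hr e w he => ?_⟩
  have hrR₀ : R₀ < r := (le_max_left _ _).trans_lt hr
  have hr2z : 2 * z < r := by linarith
  have hr0 : 0 < r := by linarith [h.one_le]
  have hnear : ∀ s, |s - r| ≤ η * r → _ := fun s hs =>
    hR₀ r hrR₀ s (hs.trans (mul_le_mul_of_nonneg_right hηη hr0.le))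
  have hs2 : ‖r • e + w‖ ^ 2 = r ^ 2 + 2 * r * ⟪e, w⟫ + ‖w‖ ^ 2 := by
    rw [norm_add_sq_real, norm_smul, he, real_inner_smul_left, mul_one, Real.norm_eq_abs, sq_abs]
    ring
  have hDr : 0 < deriv (deriv f) r * r := mul_pos (h.deriv2_pos r (by linarith [h.one_le])) hr0
  obtain ⟨d1, d2⟩ := hR₁ r ((le_max_right _ _).trans hr.le)
  rw [lt_div_iff₀ hDr] at d1
  rw [div_lt_iff₀ hDr] at d2
  refine ⟨fun hw => ?_, fun hw hz => ?_⟩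
  · refine h.excess_near hα hε hε2 hη (hηη.trans hη₀2)
      ((min_le_right _ _).trans (min_le_left _ _)) ((min_le_right _ _).trans (min_le_right _ _))
      hr2z (h.taylor hη (hηη.trans hη₀2) hr2z hnear).1
      (by linarith) (by linarith) hs2 ?_ ?_ hw
    · have := abs_real_inner_le_norm e w
      rwa [he, one_mul] at this
    · have := abs_norm_sub_norm_le (r • e + w) (r • e)
      rwa [norm_smul, he, mul_one, Real.norm_of_nonneg hr0.le, add_sub_cancel_left] at this
  · refine h.excess_far hα (show ε / 3 ≤ 1 / 2 by linarith) hη hr2z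
      (h.taylor (half_pos hη) (by linarith) hr2z fun s hs => hnear s (hs.trans ?_)).2
      hs2 ?_ hw hz
    · nlinarith
    · have := real_inner_le_norm e (r • e + w)
      rwa [he, one_mul, inner_add_right, real_inner_smul_right, real_inner_self_eq_norm_sq, he,
        one_pow, mul_one] at this

end Geometry

section Tilt

variable {n : ℕ} {α : ℝ} {f : ℝ → ℝ} {z : ℝ}

/-- The density `exp (-f ‖·‖)` divided by the exponential of the affine function tangent to
`-f ‖·‖` at the point `r • e`. -/
def tilt (f : ℝ → ℝ) (r : ℝ) (e y : EuclideanSpace ℝ (Fin n)) : ℝ :=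
  Real.exp ((f r - deriv f r * r) + (deriv f r • innerₛₗ ℝ e) y) * Real.exp (-f ‖y‖)

lemma tilt_eq (r : ℝ) (e y : EuclideanSpace ℝ (Fin n)) :
    tilt f r e y = Real.exp (f r + deriv f r * (⟪e, y⟫ - r) - f ‖y‖) := by
  rw [tilt, ← Real.exp_add, LinearMap.smul_apply, innerₛₗ_apply_apply, smul_eq_mul]
  congr 1
  ring

lemma tilt_nonneg (r : ℝ) (e y : EuclideanSpace ℝ (Fin n)) : 0 ≤ tilt f r e y := by
  rw [tilt_eq]
  positivity

lemma tilt_add (r : ℝ) {e : EuclideanSpace ℝ (Fin n)} (he : ‖e‖ = 1)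
    (w : EuclideanSpace ℝ (Fin n)) :
    tilt f r e (r • e + w) = Real.exp (-(f ‖r • e + w‖ - f r - deriv f r * ⟪e, w⟫)) := by
  rw [tilt_eq, inner_add_right, real_inner_smul_right, real_inner_self_eq_norm_sq, he]
  congr 1
  ring

lemma convPow_tilt_apply (r : ℝ) {e : EuclideanSpace ℝ (Fin n)} (he : ‖e‖ = 1) (m : ℕ) :
    convPow n (fun y => Real.exp (-f ‖y‖)) m (((m : ℝ) + 1) • r • e) =
      Real.exp (-(((m : ℝ) + 1) * f r)) * convPow n (tilt f r e) m (((m : ℝ) + 1) • r • e) := by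
  have := convPow_tilt (p := fun y => Real.exp (-f ‖y‖)) (f r - deriv f r * r)
    (deriv f r • innerₛₗ ℝ e) m (((m : ℝ) + 1) • r • e)
  change convPow n (tilt f r e) m _ = _ at this
  rw [this, ← mul_assoc, ← Real.exp_add]
  have hz : -(((m : ℝ) + 1) * f r) + (((m : ℝ) + 1) * (f r - deriv f r * r) +
      (deriv f r • innerₛₗ ℝ e) (((m : ℝ) + 1) • r • e)) = 0 := by
    rw [LinearMap.smul_apply, innerₛₗ_apply_apply, real_inner_smul_right, real_inner_smul_right,
      real_inner_self_eq_norm_sq, he, smul_eq_mul]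
    ring
  rw [hz, Real.exp_zero, one_mul]

lemma RegVaryBeyond.tilt_le_one (h : RegVaryBeyond α f z) {r : ℝ} (hr : z < r)
    {e : EuclideanSpace ℝ (Fin n)} (he : ‖e‖ = 1) {y : EuclideanSpace ℝ (Fin n)}
    (hy : z < ‖y‖) : tilt f r e y ≤ 1 := by
  rw [tilt_eq, Real.exp_le_one_iff]
  have h1 := h.tangent hr hy
  have h2 := real_inner_le_norm e y
  rw [he, one_mul] at h2
  have := mul_le_mul_of_nonneg_left h2 (h.deriv_pos r hr).le
  linarith

lemma RegVaryBeyond.tilt_le_of_norm_le (h : RegVaryBeyond α f z) {r : ℝ} (hr : z < r)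
    {e : EuclideanSpace ℝ (Fin n)} (he : ‖e‖ = 1) {y : EuclideanSpace ℝ (Fin n)}
    (hy : ‖y‖ ≤ z) :
    tilt f r e y ≤ Real.exp (f r - deriv f r * (r - z)) * Real.exp (-f ‖y‖) := by
  rw [tilt_eq, ← Real.exp_add, Real.exp_le_exp]
  have h2 := real_inner_le_norm e y
  rw [he, one_mul] at h2
  have := mul_le_mul_of_nonneg_left (h2.trans hy) (h.deriv_pos r hr).le
  linarith

/-- A linear map whose squared norm is a positive multiple of the quadratic form
`⟪e, w⟫² + (α - 1)⁻¹ (‖w‖² - ⟪e, w⟫²)`. -/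
lemma exists_linearMap_norm_sq (hn : 0 < n) (hα : 1 < α) {e : EuclideanSpace ℝ (Fin n)}
    (he : ‖e‖ = 1) {D : ℝ} (hD : 0 < D) :
    ∃ T : EuclideanSpace ℝ (Fin n) →ₗ[ℝ] EuclideanSpace ℝ (Fin n), LinearMap.det T ≠ 0 ∧
      |LinearMap.det T|⁻¹ = (√D ^ n)⁻¹ * √(α - 1) ^ (n - 1) ∧
      ∀ w, ‖T w‖ ^ 2 = D * (⟪e, w⟫ ^ 2 + (α - 1)⁻¹ * (‖w‖ ^ 2 - ⟪e, w⟫ ^ 2)) := by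
  have hβ : 0 < √(α - 1)⁻¹ := Real.sqrt_pos.2 (inv_pos.2 (by linarith))
  have hdet : LinearMap.det (√D • axialMap e √(α - 1)⁻¹) = √D ^ n * √(α - 1)⁻¹ ^ (n - 1) := by
    rw [LinearMap.det_smul, det_axialMap hn he hβ, finrank_euclideanSpace_fin]
  have hpos : 0 < √D ^ n * √(α - 1)⁻¹ ^ (n - 1) := by positivity
  refine ⟨√D • axialMap e √(α - 1)⁻¹, ?_, ?_, fun w => ?_⟩
  · rw [hdet]
    exact hpos.ne'
  · rw [hdet, abs_of_pos hpos, mul_inv, Real.sqrt_inv, inv_pow √(α - 1), inv_inv]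
  · rw [LinearMap.smul_apply, norm_smul, mul_pow, norm_axialMap_sq he hβ, Real.norm_eq_abs,
      sq_abs, Real.sq_sqrt hD.le, Real.sq_sqrt (inv_pos.2 (by linarith)).le]

/-- The local mass `(2π / f'' r)^(n/2) (α - 1)^((n-1)/2)` of the tilted density. -/
def localMass (n : ℕ) (α : ℝ) (f : ℝ → ℝ) (r : ℝ) : ℝ :=
  √(2 * π) ^ n * (√(deriv (deriv f) r) ^ n)⁻¹ * √(α - 1) ^ (n - 1)

lemma RegVaryBeyond.integral_tilt_le (h : RegVaryBeyond α f z) (hn : 0 < n) (hα : 1 < α)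
    (hp : Integrable fun y : EuclideanSpace ℝ (Fin n) => Real.exp (-f ‖y‖))
    (hp1 : ∫ y : EuclideanSpace ℝ (Fin n), Real.exp (-f ‖y‖) = 1)
    {r : ℝ} (hr : z < r) {e : EuclideanSpace ℝ (Fin n)} (he : ‖e‖ = 1) {ε η c : ℝ} (hε : ε < 1)
    (hc : 0 < c)
    (hnear : ∀ w : EuclideanSpace ℝ (Fin n), ‖w‖ ≤ η * r →
      (1 - ε) * deriv (deriv f) r * (⟪e, w⟫ ^ 2 + (α - 1)⁻¹ * (‖w‖ ^ 2 - ⟪e, w⟫ ^ 2)) / 2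
        ≤ f ‖r • e + w‖ - f r - deriv f r * ⟪e, w⟫)
    (hfar : ∀ w : EuclideanSpace ℝ (Fin n), η * r < ‖w‖ → z < ‖r • e + w‖ →
      c * ‖w‖ ≤ f ‖r • e + w‖ - f r - deriv f r * ⟪e, w⟫) :
    Integrable (tilt f r e) ∧
    ∫ y in Metric.closedBall 0 z, tilt f r e y ≤ Real.exp (f r - deriv f r * (r - z)) ∧
    ∫ y, tilt f r e y ≤ Real.exp (f r - deriv f r * (r - z)) +
      (√(1 - ε) ^ n)⁻¹ * localMass n α f r +
      Real.exp (-(c / 2 * (η * r))) * (((c / 2) ^ n)⁻¹ *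
        ∫ t : EuclideanSpace ℝ (Fin n), Real.exp (-‖t‖)) := by
  have hD := h.deriv2_pos r hr
  obtain ⟨T, hT, hTdet, hTn⟩ := exists_linearMap_norm_sq hn hα he
    (show 0 < (1 - ε) * deriv (deriv f) r from mul_pos (by linarith) hD)
  set S : EuclideanSpace ℝ (Fin n) →ₗ[ℝ] EuclideanSpace ℝ (Fin n) := (c / 2) • LinearMap.id
    with hS
  have hc2 : 0 < c / 2 := half_pos hc
  have hSdet : LinearMap.det S = (c / 2) ^ n := by
    rw [hS, LinearMap.det_smul, LinearMap.det_id, finrank_euclideanSpace_fin, mul_one]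
  have hS0 : LinearMap.det S ≠ 0 := by
    rw [hSdet]
    positivity
  have hSn : ∀ w, ‖S w‖ = c / 2 * ‖w‖ := fun w => by
    rw [hS, LinearMap.smul_apply, norm_smul, Real.norm_of_nonneg hc2.le, LinearMap.id_apply]
  set E := Real.exp (f r - deriv f r * (r - z)) with hE
  set E' := Real.exp (-(c / 2 * (η * r))) with hE'
  set H₁ : EuclideanSpace ℝ (Fin n) → ℝ := fun y => E * Real.exp (-f ‖y‖)
  set H₂ : EuclideanSpace ℝ (Fin n) → ℝ := fun w => Real.exp (-‖T w‖ ^ 2 / 2)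
  set H₃ : EuclideanSpace ℝ (Fin n) → ℝ := fun w => E' * Real.exp (-‖S w‖)
  have i₁ : Integrable H₁ := hp.const_mul _
  have i₂ : Integrable H₂ := integrable_comp_linearMap T hT integrable_gaussian_half
  have i₃ : Integrable H₃ :=
    (integrable_comp_linearMap S hS0 (integrable_exp_neg_norm hn)).const_mul _
  have hle : ∀ y, tilt f r e y ≤ H₁ y + H₂ (y - r • e) + H₃ (y - r • e) := by
    intro y
    have p₁ : 0 ≤ H₁ y := by positivity
    have p₂ : 0 ≤ H₂ (y - r • e) := by positivity
    have p₃ : 0 ≤ H₃ (y - r • e) := by positivity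
    rcases le_or_gt ‖y‖ z with hy | hy
    · have : tilt f r e y ≤ H₁ y := h.tilt_le_of_norm_le hr he hy
      linarith
    obtain ⟨w, hw⟩ : ∃ w, w = y - r • e := ⟨_, rfl⟩
    have hyw : y = r • e + w := by rw [hw]; abel
    rw [← hw] at p₂ p₃ ⊢
    rw [hyw] at p₁ hy ⊢
    rcases le_or_gt ‖w‖ (η * r) with hw' | hw'
    · have : tilt f r e (r • e + w) ≤ H₂ w := by
        rw [tilt_add r he, Real.exp_le_exp, hTn]
        have := hnear w hw'
        linarith
      linarith
    · have : tilt f r e (r • e + w) ≤ H₃ w := by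
        rw [tilt_add r he]
        simp only [H₃]
        rw [hE', ← Real.exp_add, Real.exp_le_exp, hSn]
        have h1 := hfar w hw' hy
        have h2 := mul_le_mul_of_nonneg_left hw'.le hc2.le
        linarith
      linarith
  have i₂' : Integrable fun y => H₂ (y - r • e) := i₂.comp_sub_right _
  have i₃' : Integrable fun y => H₃ (y - r • e) := i₃.comp_sub_right _
  have i₁₂ : Integrable fun y => H₁ y + H₂ (y - r • e) := i₁.add i₂'
  have iH : Integrable fun y => H₁ y + H₂ (y - r • e) + H₃ (y - r • e) := i₁₂.add i₃'
  have hm : AEStronglyMeasurable (tilt f r e) volume :=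
    (Continuous.aestronglyMeasurable (by
      have : Continuous (deriv f r • innerₛₗ ℝ e) := LinearMap.continuous_of_finiteDimensional _
      fun_prop)).mul hp.aestronglyMeasurable
  have hi : Integrable (tilt f r e) := iH.mono' hm <| ae_of_all _ fun y => by
    rw [Real.norm_of_nonneg (tilt_nonneg r e y)]
    exact hle y
  refine ⟨hi, ?_, ?_⟩
  · calc ∫ y in Metric.closedBall 0 z, tilt f r e y
        ≤ ∫ y in Metric.closedBall 0 z, H₁ y :=
          setIntegral_mono_on hi.integrableOn i₁.integrableOn
            Metric.isClosed_closedBall.measurableSet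
            fun y hy => h.tilt_le_of_norm_le hr he (by simpa using hy)
      _ ≤ ∫ y, H₁ y := setIntegral_le_integral i₁ (ae_of_all _ fun y => by positivity)
      _ = E := by rw [integral_const_mul, hp1, mul_one]
  · calc ∫ y, tilt f r e y ≤ ∫ y, (H₁ y + H₂ (y - r • e) + H₃ (y - r • e)) :=
          integral_mono hi iH hle
      _ = E + |LinearMap.det T|⁻¹ * √(2 * π) ^ n +
          E' * (|LinearMap.det S|⁻¹ * ∫ t : EuclideanSpace ℝ (Fin n), Real.exp (-‖t‖)) := by
          rw [integral_add i₁₂ i₃', integral_add i₁ i₂', integral_sub_right_eq_self H₂,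
            integral_sub_right_eq_self H₃, integral_const_mul, integral_const_mul, hp1, mul_one,
            integral_comp_linearMap T hT fun t => Real.exp (-‖t‖ ^ 2 / 2),
            integral_gaussian_half, integral_comp_linearMap S hS0 fun t => Real.exp (-‖t‖)]
      _ = _ := by
          rw [hTdet, hSdet, abs_of_pos (by positivity), localMass,
            Real.sqrt_mul (by linarith : 0 ≤ 1 - ε), mul_pow, mul_inv]
          ring

end Tilt

section Asymptotics

variable {n : ℕ} {α : ℝ} {f : ℝ → ℝ} {z : ℝ}

lemma RegVaryBeyond.localMass_pos (h : RegVaryBeyond α f z) (hα : 1 < α) {r : ℝ} (hr : z < r) :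
    0 < localMass n α f r := by
  have h1 := h.deriv2_pos r hr
  have h2 : 0 < α - 1 := by linarith
  rw [localMass]
  positivity

lemma RegVaryBeyond.le_localMass (h : RegVaryBeyond α f z) (hα : 1 < α) {r : ℝ} (hr : z < r) :
    √(2 * π) ^ n * √(α - 1) ^ (n - 1) * (√(2 * (α * (α - 1))) ^ n)⁻¹ *
      (r ^ n * (√(f r) ^ n)⁻¹) ≤ localMass n α f r := by
  have hr0 : 0 < r := by linarith [h.one_le]
  have hD := h.deriv2_pos r hr
  have hf := h.pos r hr
  have hα0 : 0 < α * (α - 1) := mul_pos (by linarith) (by linarith)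
  have h1 : r * √(deriv (deriv f) r) ≤ √(2 * (α * (α - 1))) * √(f r) := by
    rw [← Real.sqrt_mul (by positivity)]
    refine Real.le_sqrt_of_sq_le ?_
    rw [mul_pow, Real.sq_sqrt hD.le]
    exact h.deriv2_le r hr
  have h2 : (√(2 * (α * (α - 1))) ^ n)⁻¹ * (r ^ n * (√(f r) ^ n)⁻¹) ≤
      (√(deriv (deriv f) r) ^ n)⁻¹ := by
    rw [← inv_pow, ← inv_pow, ← inv_pow, ← mul_pow, ← mul_pow]
    refine pow_le_pow_left₀ (by positivity) ?_ n
    rw [← div_eq_mul_inv, ← div_eq_inv_mul, div_div, le_inv_comm₀ (by positivity) (by positivity),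
      inv_div, le_div_iff₀ hr0]
    linarith
  rw [localMass]
  calc _ = √(2 * π) ^ n * ((√(2 * (α * (α - 1))) ^ n)⁻¹ * (r ^ n * (√(f r) ^ n)⁻¹)) *
        √(α - 1) ^ (n - 1) := by ring
    _ ≤ _ := by gcongr

lemma RegVaryBeyond.eventually_exp_le_localMass (h : RegVaryBeyond α f z) (hα : 1 < α)
    {b ε : ℝ} (hb : 0 < b) (hε : 0 < ε) :
    ∀ᶠ r in atTop, Real.exp (-(b * f r)) * r ^ n ≤ ε * localMass n α f r := by
  have hα1 : 0 < α - 1 := by linarith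
  obtain ⟨c, hc⟩ : ∃ c, c = √(2 * π) ^ n * √(α - 1) ^ (n - 1) *
    (√(2 * (α * (α - 1))) ^ n)⁻¹ := ⟨_, rfl⟩
  have hc0 : 0 < c := by rw [hc]; positivity
  have hlim : Tendsto (fun t : ℝ => t ^ n * Real.exp (-b * t)) atTop (𝓝 0) := by
    have := (isLittleO_pow_exp_pos_mul_atTop n hb).tendsto_div_nhds_zero
    refine this.congr fun t => ?_
    rw [neg_mul, Real.exp_neg, div_eq_mul_inv]
  filter_upwards [h.tendsto.eventually (hlim.eventually (gt_mem_nhds (mul_pos hε hc0))),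
    h.tendsto.eventually_ge_atTop 1, eventually_gt_atTop z] with r h1 hf1 hr
  have hr0 : 0 < r := by linarith [h.one_le]
  have hf0 := h.pos r hr
  have hs : √(f r) ≤ f r := by
    rw [Real.sqrt_le_left hf0.le]
    nlinarith
  have hs' : √(f r) ^ n ≤ f r ^ n := pow_le_pow_left₀ (Real.sqrt_nonneg _) hs n
  have hle := h.le_localMass (n := n) hα hr
  rw [← hc] at hle
  calc Real.exp (-(b * f r)) * r ^ n
      = (√(f r) ^ n * Real.exp (-b * f r)) * (r ^ n * (√(f r) ^ n)⁻¹) := by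
        rw [neg_mul]
        field_simp
    _ ≤ (f r ^ n * Real.exp (-b * f r)) * (r ^ n * (√(f r) ^ n)⁻¹) := by gcongr
    _ ≤ (ε * c) * (r ^ n * (√(f r) ^ n)⁻¹) := by gcongr
    _ = ε * (c * (r ^ n * (√(f r) ^ n)⁻¹)) := by ring
    _ ≤ _ := by gcongr

lemma RegVaryBeyond.eventually_exp_tangent_le (h : RegVaryBeyond α f z) (hα : 1 < α)
    {ε : ℝ} (hε : 0 < ε) :
    ∀ᶠ r in atTop, Real.exp (f r - deriv f r * (r - z)) ≤ ε * localMass n α f r := by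
  filter_upwards [h.eventually_exp_le_localMass (n := n) hα
      (show 0 < (α - 1) / 4 by linarith) hε, eventually_gt_atTop z,
    eventually_ge_atTop (z * (2 * (α + 1) / (α - 1)))] with r h1 hr hr2
  have hz := h.one_le
  have hr0 : 0 < r := by linarith
  have hf0 := h.pos r hr
  have hd := h.le_deriv r hr
  have hα1 : 0 < α - 1 := by linarith
  refine le_trans ?_ h1
  have hE : f r - deriv f r * (r - z) ≤ -((α - 1) / 4 * f r) := by
    rw [← mul_div_assoc, div_le_iff₀ hα1] at hr2
    have h3 : r * (α + 3) ≤ (r - z) * (2 * (α + 1)) := by linarith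
    have h4 : (r * (α + 3)) * f r ≤ ((r - z) * (2 * (α + 1))) * f r := by gcongr
    have h5 : (r - z) * ((α + 1) / 2 * f r) ≤ (r - z) * (r * deriv f r) :=
      mul_le_mul_of_nonneg_left hd (by linarith)
    have h6 : r * ((α + 3) / 4 * f r) ≤ r * ((r - z) * deriv f r) := by linarith
    have := le_of_mul_le_mul_left h6 hr0
    linarith
  calc Real.exp (f r - deriv f r * (r - z)) ≤ Real.exp (-((α - 1) / 4 * f r)) * 1 := by
        rw [mul_one]
        exact Real.exp_le_exp.2 hE
    _ ≤ _ := by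
        gcongr
        exact one_le_pow₀ (by linarith)

lemma RegVaryBeyond.eventually_tail_le (h : RegVaryBeyond α f z) (hα : 1 < α)
    {c η I ε : ℝ} (hc : 0 < c) (hη : 0 < η) (hI : 0 ≤ I) (hε : 0 < ε) :
    ∀ᶠ r in atTop, Real.exp (-(c * (f r / r) / 2 * (η * r))) * (((c * (f r / r) / 2) ^ n)⁻¹ * I)
      ≤ ε * localMass n α f r := by
  have hK : 0 < ((c / 2) ^ n)⁻¹ * (I + 1) := by positivity
  filter_upwards [h.eventually_exp_le_localMass (n := n) hα (show 0 < c * η / 2 by positivity)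
      (div_pos hε hK), eventually_gt_atTop z,
    h.tendsto.eventually_ge_atTop 1] with r h1 hr hf1
  have hr0 : 0 < r := by linarith [h.one_le]
  have hexp : c * (f r / r) / 2 * (η * r) = c * η / 2 * f r := by
    field_simp
  have hinv : ((c * (f r / r) / 2) ^ n)⁻¹ ≤ r ^ n * ((c / 2) ^ n)⁻¹ := by
    rw [← inv_pow, ← inv_pow, ← mul_pow]
    refine pow_le_pow_left₀ (by positivity) ?_ n
    rw [← div_eq_mul_inv, inv_le_comm₀ (by positivity) (by positivity), inv_div]
    calc c / 2 / r = c * (1 / r) / 2 := by ring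
      _ ≤ _ := by gcongr
  rw [hexp]
  rw [div_mul_eq_mul_div ε, le_div_iff₀ hK] at h1
  calc _ ≤ Real.exp (-(c * η / 2 * f r)) * (r ^ n * ((c / 2) ^ n)⁻¹ * (I + 1)) := by
        gcongr
        linarith
    _ = Real.exp (-(c * η / 2 * f r)) * r ^ n * (((c / 2) ^ n)⁻¹ * (I + 1)) := by ring
    _ ≤ _ := h1

/-- Beyond some radius, the tilted density is integrable, its total mass is at most slightly
larger than `localMass`, and the part of it near the origin is negligible. -/
lemma SmoothRegVary.exists_integral_tilt_le (hn : 0 < n) (hα : 1 < α) (hf : SmoothRegVary α f)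
    (h : RegVaryBeyond α f z)
    (hp : Integrable fun y : EuclideanSpace ℝ (Fin n) => Real.exp (-f ‖y‖))
    (hp1 : ∫ y : EuclideanSpace ℝ (Fin n), Real.exp (-f ‖y‖) = 1) {ε : ℝ} (hε : 0 < ε) :
    ∃ R, 2 * z ≤ R ∧ ∀ r, R < r → ∀ e : EuclideanSpace ℝ (Fin n), ‖e‖ = 1 →
      Integrable (tilt f r e) ∧
      ∫ y in Metric.closedBall 0 z, tilt f r e y ≤ ε * ((1 + ε) * localMass n α f r) ∧
      ∫ y, tilt f r e y ≤ (1 + ε) * localMass n α f r := by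
  have hlim : Tendsto (fun t : ℝ => (√(1 - t) ^ n)⁻¹) (𝓝[>] 0) (𝓝 1) := by
    have : ContinuousAt (fun t : ℝ => (√(1 - t) ^ n)⁻¹) 0 := by
      refine ContinuousAt.inv₀ (by fun_prop) (by simp)
    have h2 := this.tendsto
    simp only [sub_zero, Real.sqrt_one, one_pow, inv_one] at h2
    exact h2.mono_left nhdsWithin_le_nhds
  obtain ⟨ε₁, hε₁, hε₁0, hε₁2⟩ := ((hlim.eventually
    (gt_mem_nhds (show 1 < 1 + ε / 3 by linarith))).and
    (Ioc_mem_nhdsGT (show (0 : ℝ) < 1 / 2 by norm_num))).exists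
  obtain ⟨η, hη, -, c, hc, R, hRz, hR⟩ := hf.exists_excess (n := n) hα h hε₁0 hε₁2
  have hI : 0 ≤ ∫ t : EuclideanSpace ℝ (Fin n), Real.exp (-‖t‖) :=
    integral_nonneg fun t => (Real.exp_pos _).le
  obtain ⟨R', hR'⟩ := eventually_atTop.1 ((h.eventually_exp_tangent_le (n := n) hα
    (show 0 < ε / 3 by linarith)).and
    (h.eventually_tail_le (n := n) hα hc hη hI (show 0 < ε / 3 by linarith)))
  refine ⟨max R R', hRz.trans (le_max_left _ _), fun r hr e he => ?_⟩
  have hrR : R < r := (le_max_left _ _).trans_lt hr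
  have hzr : z < r := by linarith [h.one_le]
  have hr0 : 0 < r := by linarith [h.one_le]
  obtain ⟨t1, t2⟩ := hR' r ((le_max_right _ _).trans hr.le)
  have hC := h.localMass_pos (n := n) hα hzr
  obtain ⟨g1, g2, g3⟩ := h.integral_tilt_le hn hα hp hp1 hzr he (η := η)
    (show ε₁ < 1 by linarith) (mul_pos hc (div_pos (h.pos r hzr) hr0))
    (fun w hw => ((hR r hrR e w he).1 hw).1) (fun w hw hw' => (hR r hrR e w he).2 hw hw')
  refine ⟨g1, g2.trans ?_, g3.trans ?_⟩
  · linarith [mul_pos hε hC, mul_pos hε (mul_pos hε hC)]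
  · have := mul_le_mul_of_nonneg_right hε₁.le hC.le
    linarith

lemma SmoothRegVary.exists_convPow_le (hn : 0 < n) (hα : 1 < α) (hf : SmoothRegVary α f)
    (h : RegVaryBeyond α f z)
    (hp : Integrable fun y : EuclideanSpace ℝ (Fin n) => Real.exp (-f ‖y‖))
    (hp1 : ∫ y : EuclideanSpace ℝ (Fin n), Real.exp (-f ‖y‖) = 1) {δ : ℝ} (hδ : 0 < δ) :
    ∃ R, 2 * z ≤ R ∧ ∀ r, R < r → ∀ e : EuclideanSpace ℝ (Fin n), ‖e‖ = 1 → ∀ m : ℕ,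
      convPow n (fun y => Real.exp (-f ‖y‖)) m (((m : ℝ) + 1) • r • e) ≤
        localMass n α f r ^ m * Real.exp (-(((m : ℝ) + 1) * (f r - δ))) := by
  have hδ1 : 1 < Real.exp δ := Real.one_lt_exp_iff.2 hδ
  obtain ⟨ε, hε0, hε1, hεδ, hεδ'⟩ : ∃ ε : ℝ, 0 < ε ∧ ε < 1 ∧ 1 + ε ≤ Real.exp δ ∧
      (1 - ε)⁻¹ ≤ Real.exp δ := by
    have hinv : (Real.exp δ)⁻¹ < 1 := inv_lt_one_of_one_lt₀ hδ1
    have hinv0 : 0 < (Real.exp δ)⁻¹ := by positivity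
    refine ⟨min (Real.exp δ - 1) (1 - (Real.exp δ)⁻¹), lt_min (by linarith) (by linarith),
      (min_le_right _ _).trans_lt (by linarith), ?_, ?_⟩
    · linarith [min_le_left (Real.exp δ - 1) (1 - (Real.exp δ)⁻¹)]
    · have := min_le_right (Real.exp δ - 1) (1 - (Real.exp δ)⁻¹)
      rw [inv_le_comm₀ (by linarith) (by positivity)]
      linarith
  obtain ⟨R, hRz, hR⟩ := hf.exists_integral_tilt_le hn hα h hp hp1 hε0
  refine ⟨R, hRz, fun r hr e he m => ?_⟩
  have hz := h.one_le
  have hzr : z < r := by linarith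
  have hr0 : 0 < r := by linarith
  have hC := h.localMass_pos (n := n) hα hzr
  obtain ⟨g1, g2, g3⟩ := hR r hr e he
  have hx : ((m : ℝ) + 1) * z < ‖((m : ℝ) + 1) • r • e‖ := by
    rw [norm_smul, norm_smul, he, mul_one, Real.norm_of_nonneg (by positivity),
      Real.norm_of_nonneg hr0.le]
    gcongr
  have key := convPow_le (tilt_nonneg r e) g1 hε0.le hε1 (by positivity)
    (fun y hy => h.tilt_le_one hzr he hy) g3 g2 m _ hx
  rw [convPow_tilt_apply r he]
  calc Real.exp (-(((m : ℝ) + 1) * f r)) * convPow n (tilt f r e) m (((m : ℝ) + 1) • r • e)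
      ≤ Real.exp (-(((m : ℝ) + 1) * f r)) *
        (((1 + ε) * localMass n α f r) ^ m / (1 - ε)) := by gcongr
    _ = Real.exp (-(((m : ℝ) + 1) * f r)) *
        (localMass n α f r ^ m * ((1 + ε) ^ m * (1 - ε)⁻¹)) := by
        rw [mul_pow, div_eq_mul_inv]
        ring
    _ ≤ Real.exp (-(((m : ℝ) + 1) * f r)) *
        (localMass n α f r ^ m * (Real.exp δ ^ m * Real.exp δ)) := by gcongr
    _ = _ := by
        rw [← pow_succ, ← Real.exp_nat_mul, mul_left_comm, ← Real.exp_add]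
        congr 2
        push_cast
        ring

end Asymptotics

section LowerBound

variable {n : ℕ} {α : ℝ} {f : ℝ → ℝ} {z : ℝ}

lemma SmoothRegVary.exists_le_convPow (hn : 0 < n) (hα : 1 < α) (hf : SmoothRegVary α f)
    (h : RegVaryBeyond α f z)
    (hp : Integrable fun y : EuclideanSpace ℝ (Fin n) => Real.exp (-f ‖y‖))
    (hp1 : ∫ y : EuclideanSpace ℝ (Fin n), Real.exp (-f ‖y‖) = 1) {δ : ℝ} (hδ : 0 < δ) :
    ∃ R, 2 * z ≤ R ∧ ∀ r, R < r → ∀ e : EuclideanSpace ℝ (Fin n), ‖e‖ = 1 → ∀ m : ℕ,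
      (√((m : ℝ) + 1) ^ n)⁻¹ * localMass n α f r ^ m *
          Real.exp (-(((m : ℝ) + 1) * (f r + δ))) ≤
        convPow n (fun y => Real.exp (-f ‖y‖)) m (((m : ℝ) + 1) • r • e) := by
  have hz := h.one_le
  have hlim : Tendsto (fun t : ℝ => (√(1 + t) ^ n)⁻¹) (𝓝[>] 0) (𝓝 1) := by
    have : ContinuousAt (fun t : ℝ => (√(1 + t) ^ n)⁻¹) 0 :=
      ContinuousAt.inv₀ (by fun_prop) (by simp)
    have h2 := this.tendsto
    simp only [add_zero, Real.sqrt_one, one_pow, inv_one] at h2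
    exact h2.mono_left nhdsWithin_le_nhds
  have hδ3 : Real.exp (-(δ / 3)) < 1 := Real.exp_lt_one_iff.2 (by linarith)
  have hα0 : 0 < α * (α - 1) := mul_pos (by linarith) (by linarith)
  have hβ : 0 < (α - 1)⁻¹ := inv_pos.2 (by linarith)
  obtain ⟨a, ha, ha0, ha2⟩ := ((hlim.eventually (lt_mem_nhds hδ3)).and
    (Ioc_mem_nhdsGT (show (0 : ℝ) < 1 / 2 by norm_num))).exists
  have hG : 0 < √(2 * π) ^ n := by positivity
  have hscale : Tendsto (fun K : ℝ => K * (a / (1 + a))) atTop atTop :=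
    tendsto_id.atTop_mul_const (by positivity)
  obtain ⟨K, hKG, hK⟩ := (((tendsto_gaussBall (n := n)).comp hscale).eventually
    (lt_mem_nhds (show Real.exp (-(δ / 3)) * √(2 * π) ^ n < √(2 * π) ^ n by nlinarith))
    |>.and (eventually_ge_atTop 0)).exists
  obtain ⟨η, hη, hη2, c, -, R, hRz, hR⟩ := hf.exists_excess (n := n) hα h ha0 ha2
  obtain ⟨R', -, hR'⟩ := hf.exists_integral_tilt_le hn hα h hp hp1 one_pos
  obtain ⟨b, hb⟩ : ∃ b, b = min 1 (α - 1)⁻¹ := ⟨_, rfl⟩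
  have hb0 : 0 < b := hb ▸ lt_min one_pos hβ
  obtain ⟨R'', hR''⟩ := eventually_atTop.1 (h.tendsto.eventually_gt_atTop
    ((2 * K) ^ 2 / (α * (α - 1) / 2 * (b * η ^ 2))))
  refine ⟨max (max R R') R'', hRz.trans ((le_max_left _ _).trans (le_max_left _ _)),
    fun r hr e he m => ?_⟩
  have hrR : R < r := ((le_max_left _ _).trans (le_max_left _ _)).trans_lt hr
  have hrR' : R' < r := ((le_max_right _ _).trans (le_max_left _ _)).trans_lt hr
  have hfr := hR'' r ((le_max_right _ _).trans hr.le)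
  have hzr : z < r := by linarith
  have hr0 : 0 < r := by linarith
  have hD := h.deriv2_pos r hzr
  have hC := h.localMass_pos (n := n) hα hzr
  have hpi := (hR' r hrR' e he).1
  obtain ⟨T, hT, hTdet, hTn⟩ := exists_linearMap_norm_sq hn hα he
    (show 0 < (1 + a) * deriv (deriv f) r by positivity)
  have hball : ∀ w, ‖T w‖ ≤ 2 * K → ‖w‖ ≤ η * r := by
    intro w hw
    rw [div_lt_iff₀ (by positivity)] at hfr
    have h1 : ‖T w‖ ^ 2 ≤ (2 * K) ^ 2 := pow_le_pow_left₀ (norm_nonneg _) hw 2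
    have hwi : 0 ≤ ‖w‖ ^ 2 - ⟪e, w⟫ ^ 2 := by
      have := abs_real_inner_le_norm e w
      rw [he, one_mul] at this
      rw [sub_nonneg]
      exact sq_le_sq' (abs_le.1 this).1 (abs_le.1 this).2
    have hq : b * ‖w‖ ^ 2 ≤ ⟪e, w⟫ ^ 2 + (α - 1)⁻¹ * (‖w‖ ^ 2 - ⟪e, w⟫ ^ 2) := by
      have hb1 : b ≤ 1 := hb ▸ min_le_left _ _
      have hb2 : b ≤ (α - 1)⁻¹ := hb ▸ min_le_right _ _
      linarith [mul_le_mul_of_nonneg_right hb1 (sq_nonneg ⟪e, w⟫),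
        mul_le_mul_of_nonneg_right hb2 hwi]
    have h2 : deriv (deriv f) r * (b * ‖w‖ ^ 2) ≤ ‖T w‖ ^ 2 := by
      rw [hTn]
      have : deriv (deriv f) r ≤ (1 + a) * deriv (deriv f) r := by nlinarith
      exact mul_le_mul this hq (by positivity) (by positivity)
    have h3 : (2 * K) ^ 2 < deriv (deriv f) r * (b * (η * r) ^ 2) := by
      have := mul_le_mul_of_nonneg_right (h.le_deriv2 r hzr) (show 0 ≤ b * η ^ 2 by positivity)
      linarith
    have h4 : ‖w‖ ^ 2 ≤ (η * r) ^ 2 := by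
      have : deriv (deriv f) r * b * ‖w‖ ^ 2 ≤ deriv (deriv f) r * b * (η * r) ^ 2 := by linarith
      exact le_of_mul_le_mul_left this (by positivity)
    exact (pow_le_pow_iff_left₀ (norm_nonneg _) (by positivity) two_ne_zero).1 h4
  have key := le_convPow (tilt_nonneg (f := f) r e) hT ha0 hK (ρ := r • e)
    (fun w hw => by
      rw [tilt_add r he, Real.exp_le_exp, hTn]
      linarith [((hR r hrR e w he).1 (hball w hw)).2])
    (fun k v hv => by
      refine integrable_convPow_mul (tilt_nonneg r e) hpi
        (fun y hy => h.tilt_le_one hzr he hy) k ?_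
      have h1 := norm_sub_le_norm_add (((k : ℝ) + 2) • r • e) v
      rw [norm_smul, norm_smul, he, mul_one, Real.norm_of_nonneg (by positivity),
        Real.norm_of_nonneg hr0.le] at h1
      have h2 := hball v (by linarith)
      have h3 : η * r ≤ 1 / 2 * r := by gcongr
      have h4 : ((k : ℝ) + 2) * (2 * z) < ((k : ℝ) + 2) * r := by
        gcongr
        linarith
      have h5 : 0 ≤ (k : ℝ) * r := by positivity
      linarith) m 0 (by simpa using hK)
  rw [map_zero, norm_zero, add_zero] at key
  have hmass : Real.exp (-δ) * localMass n α f r ≤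
      (√(1 + a) ^ n)⁻¹ * |LinearMap.det T|⁻¹ * gaussBall n (K * (a / (1 + a))) := by
    rw [hTdet, Real.sqrt_mul (by positivity), mul_pow, mul_inv, localMass]
    calc _ = Real.exp (-(δ / 3)) * (Real.exp (-(δ / 3)) * ((√(deriv (deriv f) r) ^ n)⁻¹) *
          √(α - 1) ^ (n - 1)) * (Real.exp (-(δ / 3)) * √(2 * π) ^ n) := by
          rw [show -δ = -(δ / 3) + -(δ / 3) + -(δ / 3) by ring, Real.exp_add, Real.exp_add]
          ring
      _ ≤ _ := by
          gcongr
          exact hKG.le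
  rw [convPow_tilt_apply r he]
  calc (√((m : ℝ) + 1) ^ n)⁻¹ * localMass n α f r ^ m * Real.exp (-(((m : ℝ) + 1) * (f r + δ)))
      ≤ (√((m : ℝ) + 1) ^ n)⁻¹ * localMass n α f r ^ m *
        (Real.exp (-(((m : ℝ) + 1) * f r)) * Real.exp (-δ) ^ m) := by
        gcongr
        rw [← Real.exp_nat_mul, ← Real.exp_add, Real.exp_le_exp]
        linarith
    _ = Real.exp (-(((m : ℝ) + 1) * f r)) *
        ((√((m : ℝ) + 1) ^ n)⁻¹ * (Real.exp (-δ) * localMass n α f r) ^ m) := by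
        rw [mul_pow]
        ring
    _ ≤ Real.exp (-(((m : ℝ) + 1) * f r)) * ((√((m : ℝ) + 1) ^ n)⁻¹ *
        ((√(1 + a) ^ n)⁻¹ * |LinearMap.det T|⁻¹ * gaussBall n (K * (a / (1 + a)))) ^ m) := by
        gcongr
    _ ≤ _ := by
        gcongr
        refine le_of_eq_of_le ?_ key
        rw [zero_pow two_ne_zero, mul_zero, neg_zero, zero_div, Real.exp_zero, mul_one]

lemma localMass_pow (hn : 0 < n) (hα : 1 < α) {r : ℝ} (hr : 0 < deriv (deriv f) r) (m : ℕ) :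
    localMass n α f r ^ m = (α - 1) ^ (((n : ℝ) - 1) * m / 2) *
      (2 * π / deriv (deriv f) r) ^ ((n : ℝ) * m / 2) := by
  have hα1 : 0 ≤ α - 1 := by linarith
  have hd : 0 ≤ 2 * π / deriv (deriv f) r := by positivity
  have hn1 : ((n - 1 : ℕ) : ℝ) = (n : ℝ) - 1 := by
    rw [Nat.cast_sub (by omega), Nat.cast_one]
  rw [localMass, ← inv_pow, ← mul_pow, ← div_eq_mul_inv, ← Real.sqrt_div (by positivity),
    mul_pow, ← pow_mul, ← pow_mul, Real.sqrt_eq_rpow, Real.sqrt_eq_rpow, ← Real.rpow_mul_natCast hd,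
    ← Real.rpow_mul_natCast hα1, mul_comm]
  push_cast
  rw [hn1]
  congr 2 <;> ring

end LowerBound

/-- Proposition 2.2: exponentially sharp bounds for the `m`-fold convolution power density
`p_m` of the probability density `exp (-f ‖·‖)` on `ℝⁿ` (here `p_m = convPow n p (m-1)`). -/
theorem stmt3 {n : ℕ} (hn : 0 < n) {α : ℝ} (hα : 1 < α) {f : ℝ → ℝ}
    (hf : SmoothRegVary α f)
    (hnorm : ∫ z : EuclideanSpace ℝ (Fin n), Real.exp (-f ‖z‖) = 1) :
    ∀ δ > (0 : ℝ), ∃ k > (0 : ℝ), ∀ m : ℕ, 1 ≤ m →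
      ∀ x : EuclideanSpace ℝ (Fin n), k * m < ‖x‖ →
        convPow n (fun z => Real.exp (-f ‖z‖)) (m - 1) x
            ≤ (α - 1) ^ (((n : ℝ) - 1) * ((m : ℝ) - 1) / 2) *
              (2 * π / deriv (deriv f) (‖x‖ / m)) ^ ((n : ℝ) * ((m : ℝ) - 1) / 2) *
              Real.exp (-(m : ℝ) * (f (‖x‖ / m) - δ)) ∧
        (m : ℝ) ^ (-(n : ℝ) / 2) * (α - 1) ^ (((n : ℝ) - 1) * ((m : ℝ) - 1) / 2) *
              (2 * π / deriv (deriv f) (‖x‖ / m)) ^ ((n : ℝ) * ((m : ℝ) - 1) / 2) *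
              Real.exp (-(m : ℝ) * (f (‖x‖ / m) + δ))
            ≤ convPow n (fun z => Real.exp (-f ‖z‖)) (m - 1) x := by
  intro δ hδ
  obtain ⟨z, h⟩ := hf.exists_beyond hα
  have hp : Integrable fun y : EuclideanSpace ℝ (Fin n) => Real.exp (-f ‖y‖) := by
    by_contra hc
    rw [integral_undef hc] at hnorm
    exact zero_ne_one hnorm
  obtain ⟨R₁, hR₁z, hR₁⟩ := hf.exists_convPow_le hn hα h hp hnorm hδ
  obtain ⟨R₂, -, hR₂⟩ := hf.exists_le_convPow hn hα h hp hnorm hδ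
  have hz := h.one_le
  refine ⟨max R₁ R₂, by linarith [le_max_left R₁ R₂], fun m hm x hx => ?_⟩
  obtain ⟨M, rfl⟩ : ∃ M, m = M + 1 := ⟨m - 1, by omega⟩
  have hM : 0 < ((M + 1 : ℕ) : ℝ) := by positivity
  rw [← lt_div_iff₀ hM] at hx
  obtain ⟨r, hr⟩ : ∃ r, r = ‖x‖ / ((M + 1 : ℕ) : ℝ) := ⟨_, rfl⟩
  rw [← hr] at hx ⊢
  have hrR₁ : R₁ < r := (le_max_left _ _).trans_lt hx
  have hrR₂ : R₂ < r := (le_max_right _ _).trans_lt hx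
  have hr0 : 0 < r := by linarith
  have hxM : ‖x‖ = ((M : ℝ) + 1) * r := by
    rw [hr]
    push_cast
    field_simp
  have hx0 : 0 < ‖x‖ := by rw [hxM]; positivity
  obtain ⟨e, he⟩ : ∃ e, e = ‖x‖⁻¹ • x := ⟨_, rfl⟩
  have he1 : ‖e‖ = 1 := by
    rw [he, norm_smul, norm_inv, norm_norm, inv_mul_cancel₀ hx0.ne']
  have hxe : x = ((M : ℝ) + 1) • r • e := by
    rw [he, smul_smul, smul_smul, ← hxM, mul_inv_cancel₀ hx0.ne', one_smul]
  have hC := localMass_pow hn hα (h.deriv2_pos r (by linarith)) M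
  have hcast : ((M + 1 : ℕ) : ℝ) - 1 = M := by
    push_cast
    ring
  have hsqrt : ((M + 1 : ℕ) : ℝ) ^ (-(n : ℝ) / 2) = (√((M : ℝ) + 1) ^ n)⁻¹ := by
    rw [neg_div, Real.rpow_neg hM.le, Real.sqrt_eq_rpow, ← Real.rpow_mul_natCast (by positivity)]
    push_cast
    congr 2
    ring
  have h1 := hR₁ r hrR₁ e he1 M
  have h2 := hR₂ r hrR₂ e he1 M
  rw [← hxe, hC] at h1 h2
  rw [hcast, hsqrt, mul_assoc (√((M : ℝ) + 1) ^ n)⁻¹, neg_mul, neg_mul, Nat.cast_succ]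
  exact ⟨h1, h2⟩
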